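/- Let S ⊆ ℝ² be a nice shape, let X ⊆ ℝ² be a finite point set in general position with respect to S, and let k ≥ 3 be an integer. For an integer j, let ℛ₁ʲ denote the set of all S-ranges S' with |X ∩ S'| = j and exactly three points of X on ∂S'. Let ℰ₁ᵏ denote the set of k-element subsets Y ⊆ X such that X ∩ S' = Y for some S-range S' with three points of X on its boundary, and for Y ∈ ℰ₁ᵏ let ℛ(Y) = {S' : S' is an S-range, X ∩ S' = Y, and |∂S' ∩ X| = 3}. Let ℰ₂ᵏ denote the set of k-element subsets Y ⊆ X that are captured by some S-range but by no S-range with three points of X on its boundary. Then 3·|ℛ₁ᵏ| + 2·|ℰ₂ᵏ| = 3·|ℛ₁^{k+1}| + |𝒜_k| + 2·Σ_{Y ∈ ℰ₁ᵏ} (|ℛ(Y)| − 1). -/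

import Mathlib

open Set

noncomputable section

/-- The Euclidean plane. -/
abbrev Pt : Type := EuclideanSpace ℝ (Fin 2)

/-- `T` is an `S`-range: a homothetic copy of `S` with positive ratio. -/
def IsRange (S T : Set Pt) : Prop :=
  ∃ (c : ℝ) (v : Pt), 0 < c ∧ T = (fun x => c • x + v) '' S

/-- A straight line in the plane. -/
def IsLine (l : Set Pt) : Prop :=
  ∃ (f : Pt →ₗ[ℝ] ℝ) (a : ℝ), f ≠ 0 ∧ l = {x | f x = a}

/-- A closed halfplane. -/
def IsClosedHalfplane (H : Set Pt) : Prop :=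
  ∃ (f : Pt →ₗ[ℝ] ℝ) (a : ℝ), f ≠ 0 ∧ H = {x | f x ≤ a}

/-- An open halfplane bounded by the line through `p` and `q`. -/
def IsOpenHalfplaneOf (p q : Pt) (L : Set Pt) : Prop :=
  ∃ (f : Pt →ₗ[ℝ] ℝ) (a : ℝ), f ≠ 0 ∧ f p = a ∧ f q = a ∧ L = {x | a < f x}

/-- `S` is a nice shape: a non-empty convex compact set such that every boundary
point has exactly one touching line and the boundary contains no non-trivial
straight line segment. -/
def NiceShape (S : Set Pt) : Prop :=
  S.Nonempty ∧ Convex ℝ S ∧ IsCompact S ∧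
  (∀ p ∈ frontier S, ∃! l : Set Pt, IsLine l ∧ l ∩ S = {p}) ∧
  (∀ x ∈ frontier S, ∀ y ∈ frontier S, segment ℝ x y ⊆ frontier S → x = y)

/-- No four points of `A` lie on the boundary of a common `S`-range. -/
def NoFourOnBoundary (S A : Set Pt) : Prop :=
  ∀ T : Set Pt, IsRange S T →
    ∀ p₁ p₂ p₃ p₄ : Pt, p₁ ∈ A ∩ frontier T → p₂ ∈ A ∩ frontier T →
      p₃ ∈ A ∩ frontier T → p₄ ∈ A ∩ frontier T →
      p₁ ≠ p₂ → p₁ ≠ p₃ → p₁ ≠ p₄ → p₂ ≠ p₃ → p₂ ≠ p₄ → p₃ ≠ p₄ → False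

/-- `X` is in general position with respect to `S`: no two points on a vertical
line, no three points collinear, and no four points on the boundary of a common
`S`-range. -/
def GenPos (S : Set Pt) (X : Finset Pt) : Prop :=
  (∀ p ∈ X, ∀ q ∈ X, p ≠ q → p 0 ≠ q 0) ∧
  (∀ p ∈ X, ∀ q ∈ X, ∀ r ∈ X, p ≠ q → p ≠ r → q ≠ r →
    ¬ Collinear ℝ ({p, q, r} : Set Pt)) ∧
  NoFourOnBoundary S ↑X

/-- The hyperedges of the `k`-uniform `S`-capturing hypergraph on `X`:
`k`-element subsets of `X` captured by some `S`-range. -/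
def capturedSets (S : Set Pt) (X : Finset Pt) (k : ℕ) : Set (Set Pt) :=
  {Y | Y ⊆ ↑X ∧ Y.ncard = k ∧ ∃ T : Set Pt, IsRange S T ∧ ↑X ∩ T = Y}

/-- The `i`-sets of `X`: `i`-element subsets of `X` separable by a straight line,
i.e. captured by a closed halfplane.  `aᵢ` is the number of such sets. -/
def iSets (X : Finset Pt) (i : ℕ) : Set (Set Pt) :=
  {Y | Y ⊆ ↑X ∧ Y.ncard = i ∧ ∃ H : Set Pt, IsClosedHalfplane H ∧ ↑X ∩ H = Y}

/-- `𝒜ᵢ`: closed halfplanes containing exactly `i` points of `X`, exactly two of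
which lie on the boundary line. -/
def repHalfplanes (X : Finset Pt) (i : ℕ) : Set (Set Pt) :=
  {H | IsClosedHalfplane H ∧ ((↑X : Set Pt) ∩ H).ncard = i ∧
    ((↑X : Set Pt) ∩ frontier H).ncard = 2}

/-- `𝒮_pq`: the `S`-ranges having both `p` and `q` on their boundary. -/
def rangesThrough (S : Set Pt) (p q : Pt) : Set (Set Pt) :=
  {T | IsRange S T ∧ p ∈ frontier T ∧ q ∈ frontier T}

/-- The ranges in `𝒮_pq` that come strictly after `S₁` (w.r.t. `≺`, i.e. inclusion
of the intersections with `L`) and have a point of `X` on their boundary that is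
not on the boundary of `S₁`. -/
def nextCandidates (S : Set Pt) (p q : Pt) (L : Set Pt) (X : Finset Pt) (S₁ : Set Pt) :
    Set (Set Pt) :=
  {S₂ | S₂ ∈ rangesThrough S p q ∧ S₁ ∩ L ⊂ S₂ ∩ L ∧
    ((frontier S₂ \ frontier S₁) ∩ ↑X).Nonempty}

/-- `ℛ₁ᵏ`: Type I ranges, i.e. `S`-ranges containing exactly `k` points of `X`,
exactly three of which are on the boundary. -/
def typeIRanges (S : Set Pt) (X : Finset Pt) (k : ℕ) : Set (Set Pt) :=
  {T | IsRange S T ∧ ((↑X : Set Pt) ∩ T).ncard = k ∧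
    ((↑X : Set Pt) ∩ frontier T).ncard = 3}

/-- `ℛ(Y)`: the Type I representative ranges of `Y`. -/
def repRanges (S : Set Pt) (X : Finset Pt) (Y : Set Pt) : Set (Set Pt) :=
  {T | IsRange S T ∧ ↑X ∩ T = Y ∧ ((↑X : Set Pt) ∩ frontier T).ncard = 3}

/-- `ℰ₁ᵏ`: Type I hyperedges. -/
def typeIEdges (S : Set Pt) (X : Finset Pt) (k : ℕ) : Set (Set Pt) :=
  {Y | Y ⊆ ↑X ∧ Y.ncard = k ∧ (repRanges S X Y).Nonempty}

/-- `ℰ₂ᵏ`: Type II hyperedges, captured by some `S`-range but by no `S`-range with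
three points of `X` on its boundary. -/
def typeIIEdges (S : Set Pt) (X : Finset Pt) (k : ℕ) : Set (Set Pt) :=
  {Y | Y ∈ capturedSets S X k ∧ ¬ (repRanges S X Y).Nonempty}

/-- Twice the signed area of the triangle `p q x`; it is positive exactly when `x` lies to the
left of the directed line from `p` to `q`. -/
def side (p q x : Pt) : ℝ :=
  (q 0 - p 0) * (x 1 - p 1) - (q 1 - p 1) * (x 0 - p 0)

lemma side_swap (p q x : Pt) : side q p x = -side p q x := by
  simp only [side]; ring

lemma side_rotate (p q x : Pt) : side q x p = side p q x := by
  simp only [side]; ring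

@[simp] lemma side_left (p q : Pt) : side p q p = 0 := by
  simp only [side]; ring

@[simp] lemma side_right (p q : Pt) : side p q q = 0 := by
  simp only [side]; ring

lemma side_combo_two (p q u v : Pt) {a b : ℝ} (h : a + b = 1) :
    side p q (a • u + b • v) = a * side p q u + b * side p q v := by
  obtain rfl : a = 1 - b := by linarith
  simp only [side, PiLp.add_apply, PiLp.smul_apply, smul_eq_mul]; ring

lemma continuous_side (p q : Pt) : Continuous (side p q) := by
  unfold side; fun_prop

lemma Pt.ext_coord {x y : Pt} (h0 : x 0 = y 0) (h1 : x 1 = y 1) : x = y := by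
  ext i; fin_cases i
  · exact h0
  · exact h1

lemma NiceShape.strictConvex {S : Set Pt} (hS : NiceShape S) : StrictConvex ℝ S := by
  obtain ⟨-, hconv, hcomp, -, hseg⟩ := hS
  intro x hx y hy hxy a b ha hb hab
  by_contra hz
  apply hxy
  have hopen : openSegment ℝ x y ⊆ frontier S := by
    intro w hw
    refine ⟨subset_closure (hconv.openSegment_subset hx hy hw), fun hwi => hz ?_⟩
    obtain ⟨c, d, hc, hd, hcd, rfl⟩ := hw
    obtain rfl : b = 1 - a := by linarith
    obtain rfl : d = 1 - c := by linarith
    rcases lt_trichotomy a c with h | h | h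
    · have := hconv.combo_interior_self_mem_interior hwi hy (a := a / c) (b := 1 - a / c)
        (by positivity) (by rw [sub_nonneg, div_le_one hc]; exact h.le) (by ring)
      convert this using 1
      apply Pt.ext_coord <;> simp <;> field_simp <;> ring
    · subst h; exact hwi
    · have := hconv.combo_interior_self_mem_interior hwi hx (a := (1 - a) / (1 - c))
        (b := 1 - (1 - a) / (1 - c))
        (by positivity) (by rw [sub_nonneg, div_le_one hd]; linarith) (by ring)
      convert this using 1
      apply Pt.ext_coord <;> simp <;> field_simp <;> ring
  have hsub : segment ℝ x y ⊆ frontier S := by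
    rw [← closure_openSegment]
    exact isClosed_frontier.closure_subset_iff.2 hopen
  exact hseg x (hsub (left_mem_segment ℝ x y)) y (hsub (right_mem_segment ℝ x y)) hsub

/-- The linear functional whose kernel is the line spanned by `w`. -/
def crossWith (w : Pt) : Pt →ₗ[ℝ] ℝ where
  toFun x := w 0 * x 1 - w 1 * x 0
  map_add' x y := by simp only [PiLp.add_apply]; ring
  map_smul' c x := by simp only [PiLp.smul_apply, smul_eq_mul, RingHom.id_apply]; ring

lemma crossWith_apply (w x : Pt) : crossWith w x = w 0 * x 1 - w 1 * x 0 := rfl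

lemma crossWith_ne_zero {w : Pt} (hw : w ≠ 0) : crossWith w ≠ 0 := by
  intro h
  apply hw
  have h0 : crossWith w !₂[0, 1] = 0 := by rw [h]; rfl
  have h1 : crossWith w !₂[1, 0] = 0 := by rw [h]; rfl
  simp [crossWith_apply] at h0 h1
  exact Pt.ext_coord (by simpa using h0) (by simpa using h1)

lemma exists_smul_of_crossWith_eq_zero {w x : Pt} (hw : w ≠ 0) (h : crossWith w x = 0) :
    ∃ t : ℝ, x = t • w := by
  rw [crossWith_apply] at h
  by_cases h0 : w 0 = 0
  · have h1 : w 1 ≠ 0 := fun h1 => hw (Pt.ext_coord (by simpa using h0) (by simpa using h1))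
    refine ⟨x 1 / w 1, Pt.ext_coord ?_ ?_⟩
    · simp only [h0, zero_mul, zero_sub, neg_eq_zero, mul_eq_zero, h1, false_or] at h
      simp [h0, h]
    · simp [h1]
  · refine ⟨x 0 / w 0, Pt.ext_coord ?_ ?_⟩
    · simp [h0]
    · simp only [PiLp.smul_apply, smul_eq_mul]; field_simp; linarith

/-- Smoothness: from a point minimising a linear functional over a nice shape, every direction in
which the functional increases enters the shape. -/
lemma NiceShape.exists_add_smul_mem {S : Set Pt} (hS : NiceShape S) {g : Pt →ₗ[ℝ] ℝ} {b w : Pt}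
    (hb : b ∈ S) (hmin : ∀ x ∈ S, x ≠ b → g b < g x) (hw : 0 < g w) :
    ∃ η : ℝ, 0 < η ∧ b + η • w ∈ S := by
  have hw0 : w ≠ 0 := by rintro rfl; simp at hw
  have hg0 : g ≠ 0 := by rintro rfl; simp at hw
  have hbf : b ∈ frontier S := by
    refine ⟨subset_closure hb, fun hbi => ?_⟩
    have hlim : Filter.Tendsto (fun t : ℝ => b - t • w) (nhdsWithin 0 (Ioi 0)) (nhds b) := by
      have : Continuous fun t : ℝ => b - t • w := by fun_prop
      simpa using (this.tendsto 0).mono_left nhdsWithin_le_nhds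
    obtain ⟨t, htS, ht⟩ := ((hlim.eventually (isOpen_interior.mem_nhds hbi)).and
      self_mem_nhdsWithin).exists
    have ht : 0 < t := ht
    have := hmin _ (interior_subset htS) (by simp [ht.ne', hw0])
    simp only [map_sub, map_smul, smul_eq_mul] at this
    nlinarith [mul_pos ht hw]
  by_contra! hno
  have h1 : IsLine {x | g x = g b} ∧ {x | g x = g b} ∩ S = {b} := by
    refine ⟨⟨g, g b, hg0, rfl⟩, ?_⟩
    ext x
    simp only [mem_inter_iff, mem_ofPred_eq, mem_singleton_iff]
    constructor
    · rintro ⟨hx, hxS⟩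
      by_contra hne
      exact absurd hx (hmin x hxS hne).ne'
    · rintro rfl; exact ⟨rfl, hb⟩
  have h2 : IsLine {x | crossWith w x = crossWith w b} ∧
      {x | crossWith w x = crossWith w b} ∩ S = {b} := by
    refine ⟨⟨_, _, crossWith_ne_zero hw0, rfl⟩, ?_⟩
    ext x
    simp only [mem_inter_iff, mem_ofPred_eq, mem_singleton_iff]
    constructor
    · rintro ⟨hx, hxS⟩
      by_contra hne
      obtain ⟨t, ht⟩ := exists_smul_of_crossWith_eq_zero hw0 (x := x - b) (by simp [hx])
      obtain rfl : x = b + t • w := by rw [← ht]; abel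
      have := hmin _ hxS hne
      simp only [map_add, map_smul, smul_eq_mul, lt_add_iff_pos_right] at this
      exact hno t (pos_of_mul_pos_left this hw.le) hxS
    · rintro rfl; exact ⟨rfl, hb⟩
  have heq := (hS.2.2.2.1 b hbf).unique h1 h2
  have hmem : b + w ∈ {x | crossWith w x = crossWith w b} := by
    simp only [mem_ofPred_eq, PiLp.add_apply, crossWith_apply]; ring
  rw [← heq] at hmem
  simp only [mem_ofPred_eq, map_add, add_eq_left] at hmem
  exact hw.ne' hmem

/-- A strictly convex set contains in its interior every proper convex combination of a point on
the left of a line with points not on the left of it. -/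
lemma StrictConvex.combo_mem_interior {T : Set Pt} (hT : StrictConvex ℝ T) {p q u v w : Pt}
    (hu : u ∈ T) (hv : v ∈ T) (hw : w ∈ T) (hsu : 0 < side p q u) (hsv : side p q v ≤ 0)
    (hsw : side p q w ≤ 0) {a b c : ℝ} (ha : 0 < a) (hb : 0 ≤ b) (hc : 0 ≤ c) (hbc : 0 < b + c)
    (h : a + b + c = 1) : a • u + b • v + c • w ∈ interior T := by
  set z : Pt := (b / (b + c)) • v + (c / (b + c)) • w with hz
  have hsum : b / (b + c) + c / (b + c) = 1 := by field_simp
  have hzT : z ∈ T := hT.convex hv hw (by positivity) (by positivity) hsum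
  have hsz : side p q z ≤ 0 := by
    rw [hz, side_combo_two _ _ _ _ hsum]
    have h1 : 0 ≤ b / (b + c) := by positivity
    have h2 : 0 ≤ c / (b + c) := by positivity
    nlinarith
  have hne : u ≠ z := by rintro rfl; linarith
  have := hT hu hzT hne ha hbc (by linarith)
  convert this using 1
  rw [hz, smul_add, smul_smul, smul_smul, mul_div_cancel₀ _ hbc.ne', mul_div_cancel₀ _ hbc.ne',
    add_assoc]

/-- A strictly convex set meets the line through two of its boundary points in a segment. -/
lemma mem_segment_of_side_eq_zero {T : Set Pt} (hT : StrictConvex ℝ T) {p q u : Pt}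
    (hpq : p ≠ q) (hpT : p ∈ T) (hqT : q ∈ T) (hp : p ∉ interior T) (hq : q ∉ interior T)
    (hu : u ∈ T) (hs : side p q u = 0) : ∃ x : ℝ, 0 ≤ x ∧ x ≤ 1 ∧ u = p + x • (q - p) := by
  have hcr : crossWith (q - p) (u - p) = 0 := by
    rw [crossWith_apply]; simpa [side] using hs
  obtain ⟨x, hx⟩ := exists_smul_of_crossWith_eq_zero (sub_ne_zero.2 hpq.symm) hcr
  obtain rfl : u = p + x • (q - p) := by rw [← hx]; abel
  have hqp : q - p ≠ 0 := sub_ne_zero.2 hpq.symm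
  refine ⟨x, ?_, ?_, rfl⟩
  · by_contra! hneg
    apply hp
    have hne : p + x • (q - p) ≠ q := by
      intro h
      have : (x - 1) • (q - p) = 0 := by
        rw [sub_smul, one_smul, sub_eq_zero]; nth_rewrite 2 [← h]; abel
      rcases smul_eq_zero.1 this with h | h
      · linarith
      · exact hqp h
    have := hT hu hqT hne (a := 1 / (1 - x)) (b := 1 - 1 / (1 - x)) (by
      apply one_div_pos.2; linarith) (by
      rw [sub_pos, div_lt_one (by linarith)]; linarith) (by ring)
    convert this using 1
    have : 1 - x ≠ 0 := by linarith
    apply Pt.ext_coord <;> simp <;> field_simp <;> ring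
  · by_contra! hneg
    apply hq
    have hne : p + x • (q - p) ≠ p := by
      intro h
      rcases smul_eq_zero.1 (add_eq_left.1 h) with h | h
      · linarith
      · exact hqp h
    have := hT hu hpT hne (a := 1 / x) (b := 1 - 1 / x) (by
      apply one_div_pos.2; linarith) (by
      rw [sub_pos, div_lt_one (by linarith)]; linarith) (by ring)
    convert this using 1
    have : x ≠ 0 := by linarith
    apply Pt.ext_coord <;> simp <;> field_simp <;> ring

lemma homothety_mem_interior_of_side_nonpos {T : Set Pt} (hT : StrictConvex ℝ T) {p q w : Pt}
    {μ : ℝ} (hμ : 0 < μ) (hpq : p ≠ q) (hpT : p ∈ T) (hqT : q ∈ T) (hp : p ∉ interior T)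
    (hq : q ∉ interior T) (hp' : μ • p + w ∈ T) (hq' : μ • q + w ∈ T)
    (hs : side p q (μ • p + w) ≤ 0) :
    (μ = 1 ∧ w = 0) ∨ ∀ u ∈ T, 0 < side p q u → μ • u + w ∈ interior T := by
  have hsq : side p q (μ • q + w) = side p q (μ • p + w) := by
    simp only [side, PiLp.add_apply, PiLp.smul_apply, smul_eq_mul]; ring
  rcases hs.lt_or_eq with hs | hs
  · right
    intro u hu hsu
    set p' : Pt := μ • p + w with hp'def
    set q' : Pt := μ • q + w with hq'def
    set y : ℝ := side p q u / (-side p q p') with hy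
    set x : ℝ := ((u 0 - p 0) * (p 1 - p' 1) - (u 1 - p 1) * (p 0 - p' 0)) / (-side p q p')
      with hx
    have hy0 : 0 < y := div_pos hsu (by linarith)
    have hu_eq : u = p + x • (q - p) + y • (p - p') := by
      have hne : -side p q p' ≠ 0 := by linarith
      have hyS : y * -side p q p' = side p q u := div_mul_cancel₀ _ hne
      have hxS : x * -side p q p' =
          (u 0 - p 0) * (p 1 - p' 1) - (u 1 - p 1) * (p 0 - p' 0) := div_mul_cancel₀ _ hne
      clear_value x y p'
      apply Pt.ext_coord <;> apply mul_left_cancel₀ hne <;>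
        simp only [PiLp.add_apply, PiLp.smul_apply, PiLp.sub_apply, smul_eq_mul, side] at *
      · linear_combination (-(q 0 - p 0)) * hxS - (p 0 - p' 0) * hyS
      · linear_combination (-(q 1 - p 1)) * hxS - (p 1 - p' 1) * hyS
    have hu0 : u 0 = p 0 + x * (q 0 - p 0) + y * (p 0 - p' 0) := by
      conv_lhs => rw [hu_eq]
      simp
    have hu1 : u 1 = p 1 + x * (q 1 - p 1) + y * (p 1 - p' 1) := by
      conv_lhs => rw [hu_eq]
      simp
    have hw0 : w 0 = p' 0 - μ * p 0 := by simp [hp'def]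
    have hw1 : w 1 = p' 1 - μ * p 1 := by simp [hp'def]
    have hq0 : q' 0 = p' 0 + μ * (q 0 - p 0) := by simp [hq'def, hw0]; ring
    have hq1 : q' 1 = p' 1 + μ * (q 1 - p 1) := by simp [hq'def, hw1]; ring
    clear_value p' q' x y
    have hx0 : 0 < x := by
      by_contra! hx0
      apply hp
      have hD : 0 < 1 - x + y := by linarith
      have := hT.combo_mem_interior hu hqT hp' hsu (by simp) hs.le (a := 1 / (1 - x + y))
        (b := -x / (1 - x + y)) (c := y / (1 - x + y)) (by positivity)
        (div_nonneg (by linarith) hD.le) (by positivity)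
        (by rw [← add_div]; exact div_pos (by linarith) hD) (by field_simp; ring)
      convert this using 1
      apply Pt.ext_coord
      · simp [hu0]; field_simp; ring
      · simp [hu1]; field_simp; ring
    have hxD : x ≤ 1 + y - μ * y := by
      by_contra! hxD
      apply hq
      have hD : 0 < x + μ * y := by linarith
      have := hT.combo_mem_interior hu hpT hq' hsu (by simp) (hsq.trans_le hs.le)
        (a := 1 / (x + μ * y))
        (b := (x + μ * y - 1 - y) / (x + μ * y)) (c := y / (x + μ * y)) (by positivity)
        (div_nonneg (by linarith) hD.le) (by positivity)
        (by rw [← add_div]; exact div_pos (by linarith) hD) (by field_simp; ring)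
      convert this using 1
      apply Pt.ext_coord
      · simp [hu0, hq0]; field_simp; ring
      · simp [hu1, hq1]; field_simp; ring
    have := hT.combo_mem_interior hu hp' hq' hsu hs.le (hsq.trans_le hs.le)
        (a := μ * y / (1 + y))
        (b := (1 + y - μ * y - x) / (1 + y)) (c := x / (1 + y)) (by positivity)
        (div_nonneg (by linarith) (by positivity)) (by positivity)
        (by rw [← add_div]; exact div_pos (by linarith) (by positivity)) (by field_simp; ring)
    convert this using 1
    apply Pt.ext_coord
    · simp [hu0, hq0, hw0]; field_simp; ring
    · simp [hu1, hq1, hw1]; field_simp; ring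
  · obtain ⟨ξ, hξ0, -, hξ⟩ := mem_segment_of_side_eq_zero hT hpq hpT hqT hp hq hp' hs
    obtain ⟨ζ, -, hζ1, hζ⟩ := mem_segment_of_side_eq_zero hT hpq hpT hqT hp hq hq' (hsq.trans hs)
    have hζξ : ζ = ξ + μ := by
      have h : (ζ - ξ - μ) • (q - p) = 0 := by
        have h1 : ζ • (q - p) = μ • q + w - p := by rw [hζ]; abel
        have h2 : ξ • (q - p) = μ • p + w - p := by rw [hξ]; abel
        rw [sub_smul, sub_smul, h1, h2, smul_sub]; abel
      rcases smul_eq_zero.1 h with h | h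
      · linarith
      · exact absurd h (sub_ne_zero.2 hpq.symm)
    have hw : w = p + ξ • (q - p) - μ • p := by rw [← hξ]; abel
    rcases (show μ ≤ 1 by linarith).lt_or_eq with hμ1 | hμ1
    · right
      intro u hu hsu
      have := hT.combo_mem_interior hu hqT hpT hsu (by simp) (by simp) hμ hξ0
        (show 0 ≤ 1 - μ - ξ by linarith) (by linarith) (by ring)
      convert this using 1
      rw [hw]
      apply Pt.ext_coord <;> simp <;> ring
    · left
      obtain rfl : ξ = 0 := by linarith
      refine ⟨hμ1, ?_⟩
      rw [hw, hμ1]; simp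

/-- A range is the preimage of any other range under a homothety. -/
lemma IsRange.exists_homothety {S T T₀ : Set Pt} (hT : IsRange S T) (hT₀ : IsRange S T₀) :
    ∃ (μ : ℝ) (w : Pt), 0 < μ ∧ (∀ x, x ∈ T₀ ↔ μ • x + w ∈ T) ∧
      ∀ x, x ∈ interior T₀ ↔ μ • x + w ∈ interior T := by
  obtain ⟨c, v, hc, rfl⟩ := hT
  obtain ⟨d, v', hd, rfl⟩ := hT₀
  have hcd : c / d ≠ 0 := by positivity
  let h : Pt ≃ₜ Pt := (Homeomorph.smulOfNeZero (c / d) hcd).trans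
    (Homeomorph.addRight (v - (c / d) • v'))
  have hh : ∀ x, h x = (c / d) • x + (v - (c / d) • v') := fun x => rfl
  have heq : (fun x => d • x + v') '' S = h ⁻¹' ((fun x => c • x + v) '' S) := by
    ext x
    simp only [mem_image, mem_preimage, hh]
    constructor
    · rintro ⟨s, hs, rfl⟩
      refine ⟨s, hs, ?_⟩
      apply Pt.ext_coord <;> simp <;> field_simp
    · rintro ⟨s, hs, hx⟩
      refine ⟨s, hs, ?_⟩
      have h0 := congrArg (fun z : Pt => z 0) hx
      have h1 := congrArg (fun z : Pt => z 1) hx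
      simp only [PiLp.add_apply, PiLp.smul_apply, PiLp.sub_apply, smul_eq_mul] at h0 h1
      field_simp at h0 h1
      apply Pt.ext_coord
      · simp; apply mul_left_cancel₀ hc.ne'; linarith
      · simp; apply mul_left_cancel₀ hc.ne'; linarith
  refine ⟨c / d, v - (c / d) • v', by positivity, fun x => ?_, fun x => ?_⟩
  · rw [heq, mem_preimage, hh]
  · rw [heq, ← h.preimage_interior, mem_preimage, hh]

lemma IsRange.isCompact {S T : Set Pt} (hS : NiceShape S) (hT : IsRange S T) : IsCompact T := by
  obtain ⟨c, v, -, rfl⟩ := hT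
  exact hS.2.2.1.image (by fun_prop)

open Pointwise in
lemma IsRange.strictConvex {S T : Set Pt} (hS : NiceShape S) (hT : IsRange S T) :
    StrictConvex ℝ T := by
  obtain ⟨c, v, hc, rfl⟩ := hT
  have heq : (fun x => c • x + v) '' S = v +ᵥ c • S := by
    rw [← Set.image_smul, ← Set.image_vadd, Set.image_image]
    simp only [vadd_eq_add, add_comm]
  rw [heq]
  exact (hS.strictConvex.smul c).vadd v

lemma IsRange.mem_of_mem_frontier {S T : Set Pt} (hS : NiceShape S) (hT : IsRange S T) {x : Pt}
    (hx : x ∈ frontier T) : x ∈ T :=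
  (hT.isCompact hS).isClosed.frontier_subset hx

lemma IsRange.mem_frontier_iff {S T : Set Pt} (hS : NiceShape S) (hT : IsRange S T) {x : Pt} :
    x ∈ frontier T ↔ x ∈ T ∧ x ∉ interior T := by
  rw [(hT.isCompact hS).isClosed.frontier_eq, mem_sdiff]

/-- Two distinct ranges cannot cross along both arcs cut off by a common chord. -/
lemma IsRange.cap_subset_interior {S T T₀ : Set Pt} (hS : NiceShape S) (hT : IsRange S T)
    (hT₀ : IsRange S T₀) (hne : T ≠ T₀) {p q : Pt} (hpq : p ≠ q) (hp : p ∈ frontier T)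
    (hq : q ∈ frontier T) (hp₀ : p ∈ T₀) (hq₀ : q ∈ T₀) :
    (∀ u ∈ T, 0 < side p q u → u ∈ interior T₀) ∨
      (∀ u ∈ T, side p q u < 0 → u ∈ interior T₀) := by
  obtain ⟨μ, w, hμ, hmem, hint⟩ := hT.exists_homothety hT₀
  rw [hT.mem_frontier_iff hS] at hp hq
  have hid : ¬ (μ = 1 ∧ w = 0) := by
    rintro ⟨rfl, rfl⟩
    apply hne
    ext x
    simp [hmem]
  rcases le_total (side p q (μ • p + w)) 0 with hs | hs
  · left
    intro u hu hsu
    rw [hint]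
    exact (homothety_mem_interior_of_side_nonpos (hT.strictConvex hS) hμ hpq hp.1 hq.1 hp.2 hq.2
      ((hmem p).1 hp₀) ((hmem q).1 hq₀) hs).resolve_left hid u hu hsu
  · right
    intro u hu hsu
    rw [hint]
    have hs' : side q p (μ • q + w) ≤ 0 := by
      have : side q p (μ • q + w) = -side p q (μ • p + w) := by
        simp only [side, PiLp.add_apply, PiLp.smul_apply, smul_eq_mul]; ring
      linarith
    exact (homothety_mem_interior_of_side_nonpos (hT.strictConvex hS) hμ hpq.symm hq.1 hp.1 hq.2
      hp.2 ((hmem q).1 hq₀) ((hmem p).1 hp₀) hs').resolve_left hid u hu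
      (by rw [side_swap]; linarith)

lemma IsPreconnected.inter_frontier_nonempty {α : Type*} [TopologicalSpace α] {s A : Set α}
    (hs : IsPreconnected s) (hA : IsClosed A) (h₁ : (s ∩ A).Nonempty) (h₂ : (s ∩ Aᶜ).Nonempty) :
    (s ∩ frontier A).Nonempty := by
  by_contra hne
  have hint : ∀ x ∈ s, x ∈ A → x ∈ interior A := by
    intro x hx hxA
    by_contra hxi
    exact hne ⟨x, hx, by rw [hA.frontier_eq]; exact ⟨hxA, hxi⟩⟩
  obtain ⟨x, hx, hxA⟩ := h₁
  obtain ⟨z, -, hz, hz'⟩ := hs (interior A) Aᶜ isOpen_interior hA.isOpen_compl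
    (fun y hy => by
      by_cases h : y ∈ A
      · exact Or.inl (hint y hy h)
      · exact Or.inr h) ⟨x, hx, hint x hx hxA⟩ h₂
  exact hz' (interior_subset hz)

section Inscribed

variable {A : Set (ℝ × ℝ)}

/-- The left end of the horizontal slice of `A` at height `t`. -/
def sliceLeft (A : Set (ℝ × ℝ)) (t : ℝ) : ℝ := sInf {s | (s, t) ∈ A}

/-- The right end of the horizontal slice of `A` at height `t`. -/
def sliceRight (A : Set (ℝ × ℝ)) (t : ℝ) : ℝ := sSup {s | (s, t) ∈ A}

lemma isCompact_slice (hA : IsCompact A) (t : ℝ) : IsCompact {s | (s, t) ∈ A} := by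
  have : {s | (s, t) ∈ A} = Prod.fst '' (A ∩ Prod.snd ⁻¹' {t}) := by
    ext s; simp
  rw [this]
  exact (hA.inter_right (isClosed_singleton.preimage continuous_snd)).image continuous_fst

lemma sliceLeft_mem (hA : IsCompact A) {s t : ℝ} (h : (s, t) ∈ A) : (sliceLeft A t, t) ∈ A :=
  (isCompact_slice hA t).sInf_mem ⟨s, h⟩

lemma sliceRight_mem (hA : IsCompact A) {s t : ℝ} (h : (s, t) ∈ A) : (sliceRight A t, t) ∈ A :=
  (isCompact_slice hA t).sSup_mem ⟨s, h⟩

lemma sliceLeft_le (hA : IsCompact A) {s t : ℝ} (h : (s, t) ∈ A) : sliceLeft A t ≤ s :=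
  csInf_le (isCompact_slice hA t).bddBelow h

lemma le_sliceRight (hA : IsCompact A) {s t : ℝ} (h : (s, t) ∈ A) : s ≤ sliceRight A t :=
  le_csSup (isCompact_slice hA t).bddAbove h

lemma sliceLeft_mem_frontier (hA : IsCompact A) {s t : ℝ} (h : (s, t) ∈ A) :
    (sliceLeft A t, t) ∈ frontier A := by
  rw [hA.isClosed.frontier_eq]
  refine ⟨sliceLeft_mem hA h, fun hi => ?_⟩
  have hlim : Filter.Tendsto (fun ε : ℝ => (sliceLeft A t - ε, t)) (nhdsWithin 0 (Ioi 0))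
      (nhds (sliceLeft A t, t)) := by
    have : Continuous fun ε : ℝ => (sliceLeft A t - ε, t) := by fun_prop
    simpa using (this.tendsto 0).mono_left nhdsWithin_le_nhds
  obtain ⟨ε, hε, hε0⟩ := ((hlim.eventually (isOpen_interior.mem_nhds hi)).and
    self_mem_nhdsWithin).exists
  have := sliceLeft_le hA (interior_subset hε)
  have hε0 : 0 < ε := hε0
  linarith

lemma sliceRight_mem_frontier (hA : IsCompact A) {s t : ℝ} (h : (s, t) ∈ A) :
    (sliceRight A t, t) ∈ frontier A := by
  rw [hA.isClosed.frontier_eq]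
  refine ⟨sliceRight_mem hA h, fun hi => ?_⟩
  have hlim : Filter.Tendsto (fun ε : ℝ => (sliceRight A t + ε, t)) (nhdsWithin 0 (Ioi 0))
      (nhds (sliceRight A t, t)) := by
    have : Continuous fun ε : ℝ => (sliceRight A t + ε, t) := by fun_prop
    simpa using (this.tendsto 0).mono_left nhdsWithin_le_nhds
  obtain ⟨ε, hε, hε0⟩ := ((hlim.eventually (isOpen_interior.mem_nhds hi)).and
    self_mem_nhdsWithin).exists
  have := le_sliceRight hA (interior_subset hε)
  have hε0 : 0 < ε := hε0
  linarith

lemma convexOn_sliceLeft (hA : IsCompact A) (hconv : Convex ℝ A) {m M : ℝ}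
    (hne : ∀ t ∈ Ioo m M, ∃ s, (s, t) ∈ A) : ConvexOn ℝ (Ioo m M) (sliceLeft A) := by
  refine ⟨convex_Ioo m M, fun x hx y hy a b ha hb hab => sliceLeft_le hA ?_⟩
  obtain ⟨s, hs⟩ := hne x hx
  obtain ⟨s', hs'⟩ := hne y hy
  exact hconv (sliceLeft_mem hA hs) (sliceLeft_mem hA hs') ha hb hab

lemma concaveOn_sliceRight (hA : IsCompact A) (hconv : Convex ℝ A) {m M : ℝ}
    (hne : ∀ t ∈ Ioo m M, ∃ s, (s, t) ∈ A) : ConcaveOn ℝ (Ioo m M) (sliceRight A) := by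
  refine ⟨convex_Ioo m M, fun x hx y hy a b ha hb hab => le_sliceRight hA ?_⟩
  obtain ⟨s, hs⟩ := hne x hx
  obtain ⟨s', hs'⟩ := hne y hy
  exact hconv (sliceRight_mem hA hs) (sliceRight_mem hA hs') ha hb hab

/-- If `A` is convex and contains points going out of `b` in the two directions `(±1, σ)`, it
contains a small triangle with apex `b`. -/
lemma Convex.exists_triangle_subset (hconv : Convex ℝ A) {b : ℝ × ℝ} (hb : b ∈ A) {σ : ℝ}
    (h₁ : ∃ η : ℝ, 0 < η ∧ b + η • ((1, σ) : ℝ × ℝ) ∈ A)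
    (h₂ : ∃ η : ℝ, 0 < η ∧ b + η • ((-1, σ) : ℝ × ℝ) ∈ A) :
    ∃ η : ℝ, 0 < η ∧ ∀ τ s : ℝ, 0 < τ → τ ≤ η → |s| ≤ τ → (b.1 + s, b.2 + σ * τ) ∈ A := by
  obtain ⟨η₁, hη₁, hA₁⟩ := h₁
  obtain ⟨η₂, hη₂, hA₂⟩ := h₂
  refine ⟨min η₁ η₂, lt_min hη₁ hη₂, fun τ s hτ hτη hs => ?_⟩
  rw [abs_le] at hs
  have hτ₁ := hτη.trans (min_le_left _ _)
  have hτ₂ := hτη.trans (min_le_right _ _)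
  have hr : b + τ • ((1, σ) : ℝ × ℝ) ∈ A := by
    have := hconv hb hA₁ (a := 1 - τ / η₁) (b := τ / η₁)
      (by rw [sub_nonneg, div_le_one hη₁]; exact hτ₁) (by positivity) (by ring)
    convert this using 1
    ext <;> simp <;> field_simp <;> ring
  have hl : b + τ • ((-1, σ) : ℝ × ℝ) ∈ A := by
    have := hconv hb hA₂ (a := 1 - τ / η₂) (b := τ / η₂)
      (by rw [sub_nonneg, div_le_one hη₂]; exact hτ₂) (by positivity) (by ring)
    convert this using 1
    ext <;> simp <;> field_simp <;> ring
  have := hconv hr hl (a := (τ + s) / (2 * τ)) (b := (τ - s) / (2 * τ))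
    (div_nonneg (by linarith) (by positivity)) (div_nonneg (by linarith) (by positivity))
    (by field_simp; ring)
  convert this using 1
  ext <;> simp <;> field_simp <;> ring

/-- A compact convex planar set that is smooth and strictly convex at its lowest and highest
points has an inscribed isosceles right triangle with horizontal and vertical legs. -/
lemma exists_inscribed_right_triangle (hA : IsCompact A) (hconv : Convex ℝ A) {b t : ℝ × ℝ}
    (hb : b ∈ A) (ht : t ∈ A) (hmin : ∀ x ∈ A, x ≠ b → b.2 < x.2) (hmax : ∀ x ∈ A, x.2 ≤ t.2)
    (hbs : ∀ w : ℝ × ℝ, 0 < w.2 → ∃ η : ℝ, 0 < η ∧ b + η • w ∈ A)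
    (hts : ∀ w : ℝ × ℝ, w.2 < 0 → ∃ η : ℝ, 0 < η ∧ t + η • w ∈ A) :
    ∃ (a : ℝ × ℝ) (l : ℝ), 0 < l ∧ a ∈ frontier A ∧ a + (l, 0) ∈ frontier A ∧
      a + (0, l) ∈ frontier A := by
  obtain ⟨η, hη, hηA⟩ := hconv.exists_triangle_subset hb (hbs (1, 1) one_pos)
    (hbs (-1, 1) one_pos)
  obtain ⟨θ, hθ, hθA⟩ := hconv.exists_triangle_subset ht (hts (1, -1) (by simp))
    (hts (-1, -1) (by simp))
  have hηt : b.2 + η ≤ t.2 := by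
    simpa using hmax _ (hηA η 0 hη le_rfl (by simpa using hη.le))
  have hbt : b.2 < t.2 := by linarith
  have hθb : b.2 ≤ t.2 - θ := by
    have h := hθA θ 0 hθ le_rfl (by simpa using hθ.le)
    by_cases hx : ((t.1 + 0, t.2 + -1 * θ) : ℝ × ℝ) = b
    · rw [← hx]; simp
    · have := hmin _ h hx
      simp at this; linarith
  have hne : ∀ y ∈ Ioo b.2 t.2, ∃ s, (s, y) ∈ A := by
    intro y hy
    refine ⟨((t.2 - y) / (t.2 - b.2)) * b.1 + ((y - b.2) / (t.2 - b.2)) * t.1, ?_⟩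
    have hd : 0 < t.2 - b.2 := by linarith
    have := hconv hb ht (a := (t.2 - y) / (t.2 - b.2)) (b := (y - b.2) / (t.2 - b.2))
      (div_nonneg (by linarith [hy.2]) hd.le) (div_nonneg (by linarith [hy.1]) hd.le)
      (by field_simp; ring)
    convert this using 1
    ext <;> simp
    field_simp; ring
  set γ : ℝ → ℝ × ℝ := fun y => (sliceLeft A y, y + (sliceRight A y - sliceLeft A y)) with hγ
  have hcont : ContinuousOn γ (Ioo b.2 t.2) := by
    have hl := (convexOn_sliceLeft hA hconv hne).continuousOn isOpen_Ioo
    have hr := (concaveOn_sliceRight hA hconv hne).continuousOn isOpen_Ioo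
    exact hl.prodMk (continuousOn_id.add (hr.sub hl))
  have hlow : (γ '' Ioo b.2 t.2 ∩ A).Nonempty := by
    obtain ⟨δ, hδ, hδA⟩ : ∃ δ > 0, ∀ x ∈ A, x.2 ≤ b.2 + δ → |x.1 - b.1| ≤ η / 4 := by
      by_cases hKne : (A ∩ {x : ℝ × ℝ | η / 4 ≤ |x.1 - b.1|}).Nonempty
      · have hK : IsCompact (A ∩ {x : ℝ × ℝ | η / 4 ≤ |x.1 - b.1|}) :=
          hA.inter_right (isClosed_le (by fun_prop) (by fun_prop))
        obtain ⟨z, hz, hzmin⟩ := hK.exists_isMinOn hKne continuous_snd.continuousOn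
        have hzb : z ≠ b := by
          rintro rfl
          have := hz.2
          simp at this
          linarith
        have hzb' := hmin z hz.1 hzb
        refine ⟨(z.2 - b.2) / 2, by linarith, fun x hx hxδ => ?_⟩
        by_contra! hlt
        have := hzmin ⟨hx, hlt.le⟩
        have h2 : z.2 ≤ x.2 := this
        linarith
      · refine ⟨1, one_pos, fun x hx _ => ?_⟩
        by_contra! hlt
        exact hKne ⟨x, hx, hlt.le⟩
    set τ : ℝ := min δ (η / 4) with hτ
    have hτ0 : 0 < τ := lt_min hδ (by linarith)
    have hτδ : τ ≤ δ := min_le_left _ _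
    have hτη : τ ≤ η / 4 := min_le_right _ _
    have h1 : (b.1 + 0, b.2 + 1 * τ) ∈ A := hηA τ 0 hτ0 (by linarith) (by simpa using hτ0.le)
    rw [one_mul] at h1
    have hL := hδA _ (sliceLeft_mem hA h1) (by simpa using hτδ)
    have hR := hδA _ (sliceRight_mem hA h1) (by simpa using hτδ)
    have hLb := sliceLeft_le hA h1
    have hRb := le_sliceRight hA h1
    simp only [abs_le] at hL hR
    refine ⟨γ (b.2 + τ), ⟨b.2 + τ, ⟨by linarith, by linarith⟩, rfl⟩, ?_⟩
    have := hηA (τ + (sliceRight A (b.2 + τ) - sliceLeft A (b.2 + τ)))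
      (sliceLeft A (b.2 + τ) - b.1) (by linarith) (by linarith)
      (by rw [abs_le]; constructor <;> linarith)
    convert this using 1
    ext <;> simp [hγ]
    ring
  have hhigh : (γ '' Ioo b.2 t.2 ∩ Aᶜ).Nonempty := by
    have h1 : (t.1 + θ / 2, t.2 + -1 * (θ / 2)) ∈ A :=
      hθA (θ / 2) (θ / 2) (by linarith) (by linarith) (by rw [abs_of_pos]; linarith)
    have h2 : (t.1 + -(θ / 2), t.2 + -1 * (θ / 2)) ∈ A :=
      hθA (θ / 2) (-(θ / 2)) (by linarith) (by linarith) (by rw [abs_neg, abs_of_pos]; linarith)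
    have hL := sliceLeft_le hA h2
    have hR := le_sliceRight hA h1
    refine ⟨γ (t.2 + -1 * (θ / 2)), ⟨_, ⟨by linarith, by linarith⟩, rfl⟩, fun hmem => ?_⟩
    have := hmax _ hmem
    simp only [hγ] at this
    linarith
  obtain ⟨-, ⟨y, hy, rfl⟩, hyf⟩ := (isPreconnected_Ioo.image γ hcont).inter_frontier_nonempty
    hA.isClosed hlow hhigh
  obtain ⟨s, hs⟩ := hne y hy
  have hlr : sliceLeft A y ≤ sliceRight A y := (sliceLeft_le hA hs).trans (le_sliceRight hA hs)
  refine ⟨(sliceLeft A y, y), sliceRight A y - sliceLeft A y, ?_, sliceLeft_mem_frontier hA hs,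
    ?_, ?_⟩
  · rcases hlr.lt_or_eq with h | h
    · linarith
    · exfalso
      set κ : ℝ := min (y - b.2) η with hκ
      have hyb : 0 < y - b.2 := by linarith [hy.1]
      have hκ0 : 0 < κ := lt_min hyb hη
      have h1 : (b.1 + κ, b.2 + 1 * κ) ∈ A := hηA κ κ hκ0 (min_le_right _ _)
        (by rw [abs_of_pos hκ0])
      have h2 : (b.1 + -κ, b.2 + 1 * κ) ∈ A := hηA κ (-κ) hκ0 (min_le_right _ _)
        (by rw [abs_neg, abs_of_pos hκ0])
      have h3 : ∀ z ∈ A, b.2 < z.2 → z.2 ≤ y →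
          ((t.2 - y) / (t.2 - z.2)) * z.1 + ((y - z.2) / (t.2 - z.2)) * t.1 = sliceLeft A y := by
        intro z hz hzb hzy
        have hd : 0 < t.2 - z.2 := by linarith [hy.2]
        have hmem := hconv hz ht (a := (t.2 - y) / (t.2 - z.2)) (b := (y - z.2) / (t.2 - z.2))
          (div_nonneg (by linarith [hy.2]) hd.le) (div_nonneg (by linarith) hd.le)
          (by field_simp; ring)
        have hmem' : (((t.2 - y) / (t.2 - z.2)) * z.1 + ((y - z.2) / (t.2 - z.2)) * t.1, y) ∈
            A := by
          convert hmem using 1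
          ext <;> simp
          field_simp; ring
        exact le_antisymm ((le_sliceRight hA hmem').trans h.ge) (sliceLeft_le hA hmem')
      have e1 := h3 _ h1 (by simp; exact hκ0) (by simp; linarith [min_le_left (y - b.2) η])
      have e2 := h3 _ h2 (by simp; exact hκ0) (by simp; linarith [min_le_left (y - b.2) η])
      simp only at e1 e2
      have hd : 0 < t.2 - (b.2 + 1 * κ) := by linarith [hy.2, min_le_left (y - b.2) η]
      have : (t.2 - y) / (t.2 - (b.2 + 1 * κ)) * (2 * κ) = 0 := by linarith
      have hpos : 0 < (t.2 - y) / (t.2 - (b.2 + 1 * κ)) * (2 * κ) :=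
        mul_pos (div_pos (by linarith [hy.2]) hd) (by linarith)
      linarith
  · convert sliceRight_mem_frontier hA hs using 1
    ext <;> simp
  · convert hyf using 1
    ext <;> simp [hγ]

end Inscribed

lemma exists_lt_of_mem_interior {S : Set Pt} {m w : Pt} (hm : m ∈ interior S)
    {g : Pt →ₗ[ℝ] ℝ} (hw : g w < 0) : ∃ x ∈ S, g x < g m := by
  have hlim : Filter.Tendsto (fun t : ℝ => m + t • w) (nhdsWithin 0 (Ioi 0)) (nhds m) := by
    have : Continuous fun t : ℝ => m + t • w := by fun_prop
    simpa using (this.tendsto 0).mono_left nhdsWithin_le_nhds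
  obtain ⟨t, ht, ht0⟩ := ((hlim.eventually (isOpen_interior.mem_nhds hm)).and
    self_mem_nhdsWithin).exists
  refine ⟨_, interior_subset ht, ?_⟩
  rw [map_add, map_smul, smul_eq_mul]
  linarith [mul_neg_of_pos_of_neg (show 0 < t from ht0) hw]

lemma StrictConvex.exists_unique_minimizer {S : Set Pt} (hconv : StrictConvex ℝ S)
    (hcomp : IsCompact S) (hne : S.Nonempty) {g : Pt →ₗ[ℝ] ℝ} {w : Pt} (hw : g w < 0) :
    ∃ b ∈ S, ∀ x ∈ S, x ≠ b → g b < g x := by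
  obtain ⟨b, hb, hmin⟩ := hcomp.exists_isMinOn hne
    (LinearMap.continuous_of_finiteDimensional g).continuousOn
  refine ⟨b, hb, fun x hx hxb => (hmin hx).lt_of_ne fun heq => ?_⟩
  have hm := hconv hx hb hxb (a := 1 / 2) (b := 1 / 2) (by norm_num) (by norm_num) (by norm_num)
  obtain ⟨y, hy, hlt⟩ := exists_lt_of_mem_interior hm hw
  rw [map_add, map_smul, map_smul, ← heq, smul_eq_mul] at hlt
  have h1 : g b ≤ g y := hmin hy
  linarith

/-- The linear coordinates `(s, t) ↦ s • e + t • d` of the plane. -/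
def basisHomeomorph (e d : Pt) (h : crossWith e d ≠ 0) : ℝ × ℝ ≃ₜ Pt where
  toFun z := z.1 • e + z.2 • d
  invFun x := (-crossWith d x / crossWith e d, crossWith e x / crossWith e d)
  left_inv z := by
    have h1 : crossWith d e = -crossWith e d := by simp only [crossWith_apply]; ring
    have h2 : crossWith d d = 0 := by simp only [crossWith_apply]; ring
    have h3 : crossWith e e = 0 := by simp only [crossWith_apply]; ring
    ext <;> simp [h1, h2, h3, h]
  right_inv x := by
    apply Pt.ext_coord <;> simp <;> field_simp <;> simp only [crossWith_apply] <;> ring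
  continuous_toFun := by fun_prop
  continuous_invFun := by
    have h1 := LinearMap.continuous_of_finiteDimensional (crossWith d)
    have h2 := LinearMap.continuous_of_finiteDimensional (crossWith e)
    fun_prop

lemma basisHomeomorph_apply (e d : Pt) (h : crossWith e d ≠ 0) (z : ℝ × ℝ) :
    basisHomeomorph e d h z = z.1 • e + z.2 • d := rfl

lemma IsRange.of_homothety (S : Set Pt) {l : ℝ} (hl : 0 < l) (a p : Pt) :
    ∃ T, IsRange S T ∧ ∀ x, a + l • x ∈ frontier S → p + x ∈ frontier T := by
  have hl' : l⁻¹ ≠ 0 := by positivity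
  let h : Pt ≃ₜ Pt := (Homeomorph.smulOfNeZero l⁻¹ hl').trans (Homeomorph.addRight (p - l⁻¹ • a))
  refine ⟨h '' S, ⟨l⁻¹, p - l⁻¹ • a, by positivity, rfl⟩, fun x hx => ?_⟩
  rw [← h.image_frontier]
  refine ⟨_, hx, ?_⟩
  change l⁻¹ • (a + l • x) + (p - l⁻¹ • a) = p + x
  rw [smul_add, smul_smul, inv_mul_cancel₀ hl.ne', one_smul]
  abel

lemma NiceShape.exists_range_through_of_side_pos {S : Set Pt} (hS : NiceShape S) {p q r : Pt}
    (h : 0 < side p q r) :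
    ∃ T, IsRange S T ∧ p ∈ frontier T ∧ q ∈ frontier T ∧ r ∈ frontier T := by
  set e := q - p with he
  set d := r - p with hd
  have hD : 0 < crossWith e d := by
    rw [crossWith_apply]; simpa [side, he, hd] using h
  obtain ⟨b, hb, hbmin⟩ := hS.strictConvex.exists_unique_minimizer hS.2.2.1 hS.1
    (g := crossWith e) (w := -d) (by simpa using hD)
  obtain ⟨t, ht, htmax⟩ := hS.strictConvex.exists_unique_minimizer hS.2.2.1 hS.1
    (g := -crossWith e) (w := d) (by simpa using hD)
  set φ := basisHomeomorph e d hD.ne' with hφ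
  have hee : crossWith e e = 0 := by simp only [crossWith_apply]; ring
  have hg : ∀ z : ℝ × ℝ, crossWith e (φ z) = z.2 * crossWith e d := fun z => by
    rw [hφ, basisHomeomorph_apply]; simp [hee]
  have hlin : ∀ (z w : ℝ × ℝ) (η : ℝ), φ (z + η • w) = φ z + η • φ w := fun z w η => by
    simp only [hφ, basisHomeomorph_apply, Prod.fst_add, Prod.snd_add, Prod.smul_fst,
      Prod.smul_snd, smul_eq_mul, add_smul, smul_add, smul_smul]
    abel
  have hgs : ∀ x : Pt, (φ.symm x).2 * crossWith e d = crossWith e x := fun x => by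
    rw [← hg, φ.apply_symm_apply]
  have hconv : Convex ℝ (φ ⁻¹' S) :=
    hS.2.1.is_linear_preimage ⟨fun x y => by simpa using hlin x y 1, fun c x => by
      simp [hφ, basisHomeomorph_apply, smul_smul]⟩
  obtain ⟨a, l, hl, h1, h2, h3⟩ := exists_inscribed_right_triangle
    (A := φ ⁻¹' S) (φ.isCompact_preimage.2 hS.2.2.1) hconv
    (b := φ.symm b) (t := φ.symm t) (by simpa using hb) (by simpa using ht)
    (fun x hx hxb => by
      have := hbmin (φ x) hx fun h => hxb (by rw [← h, φ.symm_apply_apply])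
      rw [hg, ← hgs b] at this
      exact lt_of_mul_lt_mul_right this hD.le)
    (fun x hx => by
      by_cases hxt : φ x = t
      · rw [← hxt, φ.symm_apply_apply]
      · have := htmax (φ x) hx hxt
        simp only [LinearMap.neg_apply, neg_lt_neg_iff] at this
        rw [hg, ← hgs t] at this
        exact (lt_of_mul_lt_mul_right this hD.le).le)
    (fun w hw => by
      obtain ⟨η, hη, hmem⟩ := hS.exists_add_smul_mem hb hbmin (w := φ w)
        (by rw [hg]; positivity)
      refine ⟨η, hη, ?_⟩
      rw [mem_preimage, hlin, φ.apply_symm_apply]; exact hmem)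
    (fun w hw => by
      obtain ⟨η, hη, hmem⟩ := hS.exists_add_smul_mem ht htmax (w := φ w)
        (by rw [LinearMap.neg_apply, hg]; nlinarith)
      refine ⟨η, hη, ?_⟩
      rw [mem_preimage, hlin, φ.apply_symm_apply]; exact hmem)
  rw [← φ.preimage_frontier, mem_preimage] at h1 h2 h3
  obtain ⟨T, hT, hTf⟩ := IsRange.of_homothety S hl (φ a) p
  have hφe : φ (a + (l, 0)) = φ a + l • e := by
    simp [hφ, basisHomeomorph_apply, add_smul]; abel
  have hφd : φ (a + (0, l)) = φ a + l • d := by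
    simp [hφ, basisHomeomorph_apply, add_smul]; abel
  rw [hφe] at h2
  rw [hφd] at h3
  refine ⟨T, hT, ?_, ?_, ?_⟩
  · simpa using hTf 0 (by simpa using h1)
  · simpa [he] using hTf e h2
  · simpa [hd] using hTf d h3

/-- Through any three non-collinear points there passes the boundary of some range. -/
lemma NiceShape.exists_range_through {S : Set Pt} (hS : NiceShape S) {p q r : Pt}
    (h : side p q r ≠ 0) :
    ∃ T, IsRange S T ∧ p ∈ frontier T ∧ q ∈ frontier T ∧ r ∈ frontier T := by
  rcases h.lt_or_gt with h | h
  · obtain ⟨T, hT, hq, hp, hr⟩ := hS.exists_range_through_of_side_pos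
      (p := q) (q := p) (r := r) (by rw [side_swap]; linarith)
    exact ⟨T, hT, hp, hq, hr⟩
  · exact hS.exists_range_through_of_side_pos h

/-- A point of the boundary of a convex set beyond the chord `p q`, on its negative side. -/
lemma IsRange.exists_frontier_side_neg {S T : Set Pt} (hS : NiceShape S) (hT : IsRange S T)
    {p q : Pt} (hpq : p ≠ q) (hp : p ∈ T) (hq : q ∈ T) :
    ∃ b ∈ frontier T, side p q b < 0 := by
  have hd : ∀ x, crossWith (q - p) x = side p q x + crossWith (q - p) p := fun x => by
    simp only [crossWith_apply, side, PiLp.sub_apply]; ring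
  have hw : crossWith (q - p) !₂[q 1 - p 1, -(q 0 - p 0)] < 0 := by
    have : 0 < (q 0 - p 0) ^ 2 + (q 1 - p 1) ^ 2 := by
      by_contra! hle
      apply hpq
      refine Pt.ext_coord ?_ ?_ <;> nlinarith [sq_nonneg (q 0 - p 0), sq_nonneg (q 1 - p 1)]
    simp [crossWith_apply]; nlinarith
  obtain ⟨b, hb, hmin⟩ := (hT.strictConvex hS).exists_unique_minimizer (hT.isCompact hS) ⟨p, hp⟩ hw
  refine ⟨b, (hT.mem_frontier_iff hS).2 ⟨hb, fun hbi => ?_⟩, ?_⟩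
  · obtain ⟨x, hx, hlt⟩ := exists_lt_of_mem_interior hbi hw
    exact lt_asymm hlt (hmin x hx (by rintro rfl; exact lt_irrefl _ hlt))
  · by_cases hpb : p = b
    · have := hmin q hq (by rw [← hpb]; exact hpq.symm)
      rw [hd, hd q, ← hpb] at this
      simp at this
    · have := hmin p hp hpb
      rw [hd, hd p] at this
      simpa using this

lemma IsRange.eq_of_frontier {S T T' : Set Pt} (hS : NiceShape S) (hT : IsRange S T)
    (hT' : IsRange S T') {p q r : Pt} (h : side p q r ≠ 0) (hp : p ∈ frontier T)
    (hq : q ∈ frontier T) (hr : r ∈ frontier T) (hp' : p ∈ frontier T') (hq' : q ∈ frontier T')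
    (hr' : r ∈ frontier T') : T = T' := by
  wlog hpos : 0 < side p q r generalizing p q
  · exact this (p := q) (q := p) (by rw [side_swap]; simpa using h) hq hp hq' hp'
      (by rw [side_swap]; have := lt_of_le_of_ne (not_lt.1 hpos) h; linarith)
  by_contra hne
  have hpq : p ≠ q := by rintro rfl; simp [side] at h
  have mem : ∀ {T x}, IsRange S T → x ∈ frontier T → x ∈ T := fun hT hx =>
    hT.mem_of_mem_frontier hS hx
  obtain ⟨b, hb, hbs⟩ := hT.exists_frontier_side_neg hS hpq (mem hT hp) (mem hT hq)
  rcases hT.cap_subset_interior hS hT' hne hpq hp hq (mem hT' hp') (mem hT' hq') with h1 | h1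
  · exact hr'.2 (h1 r (mem hT hr) hpos)
  rcases hT'.cap_subset_interior hS hT (Ne.symm hne) hpq hp' hq' (mem hT hp) (mem hT hq)
    with h2 | h2
  · exact hr.2 (h2 r (mem hT' hr') hpos)
  · exact hb.2 (h2 b (interior_subset (h1 b (mem hT hb) hbs)) hbs)

lemma IsRange.cap_dichotomy {S T T' : Set Pt} (hS : NiceShape S) (hT : IsRange S T)
    (hT' : IsRange S T') (hne : T ≠ T') {p q : Pt} (hpq : p ≠ q) (hp : p ∈ frontier T)
    (hq : q ∈ frontier T) (hp' : p ∈ frontier T') (hq' : q ∈ frontier T') :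
    ((∀ u ∈ T, 0 < side p q u → u ∈ interior T') ∧ ∀ u ∈ T', side p q u < 0 → u ∈ interior T) ∨
      ((∀ u ∈ T, side p q u < 0 → u ∈ interior T') ∧
        ∀ u ∈ T', 0 < side p q u → u ∈ interior T) := by
  have mem : ∀ {T x}, IsRange S T → x ∈ frontier T → x ∈ T := fun hT hx =>
    hT.mem_of_mem_frontier hS hx
  rcases hT.cap_subset_interior hS hT' hne hpq hp hq (mem hT' hp') (mem hT' hq') with h1 | h1 <;>
    rcases hT'.cap_subset_interior hS hT hne.symm hpq hp' hq' (mem hT hp) (mem hT hq) with h2 | h2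
  · obtain ⟨b, hb, hbs⟩ := hT.exists_frontier_side_neg hS hpq.symm (mem hT hq) (mem hT hp)
    rw [side_swap, neg_lt_zero] at hbs
    exact absurd (h2 b (interior_subset (h1 b (mem hT hb) hbs)) hbs) hb.2
  · exact Or.inl ⟨h1, h2⟩
  · exact Or.inr ⟨h1, h2⟩
  · obtain ⟨b, hb, hbs⟩ := hT.exists_frontier_side_neg hS hpq (mem hT hp) (mem hT hq)
    exact absurd (h2 b (interior_subset (h1 b (mem hT hb) hbs)) hbs) hb.2

/-- `P` parametrises the ranges with `p` and `q` on the boundary, growing on the positive side of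
`p q` and shrinking on the negative one; `P (thr x)` is the one with `x` on the boundary. -/
structure IsPencil (S : Set Pt) (p q : Pt) (P : ℝ → Set Pt) (thr : Pt → ℝ) : Prop where
  isRange : ∀ t, IsRange S (P t)
  left : ∀ t, p ∈ frontier (P t)
  right : ∀ t, q ∈ frontier (P t)
  exists_eq : ∀ T, IsRange S T → p ∈ frontier T → q ∈ frontier T → ∃ t, T = P t
  pos_lt : ∀ {s t u}, s < t → u ∈ P s → 0 < side p q u → u ∈ interior (P t)
  neg_lt : ∀ {s t u}, s < t → u ∈ P t → side p q u < 0 → u ∈ interior (P s)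
  thr_mem : ∀ x, side p q x ≠ 0 → x ∈ frontier (P (thr x))

lemma exists_isPencil {S : Set Pt} (hS : NiceShape S) {p q : Pt} (hpq : p ≠ q) :
    ∃ P thr, IsPencil S p q P thr := by
  have mem : ∀ {T x}, IsRange S T → x ∈ frontier T → x ∈ T := fun hT hx =>
    hT.mem_of_mem_frontier hS hx
  set m : Pt := (1 / 2 : ℝ) • p + (1 / 2 : ℝ) • q with hm
  set n : Pt := !₂[-(q 1 - p 1), q 0 - p 0] with hn
  set f : ℝ → Pt := fun s => m + s • n with hf
  set N : ℝ := (q 0 - p 0) ^ 2 + (q 1 - p 1) ^ 2 with hN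
  have hNpos : 0 < N := by
    by_contra! hle
    apply hpq
    refine Pt.ext_coord ?_ ?_ <;> nlinarith [sq_nonneg (q 0 - p 0), sq_nonneg (q 1 - p 1)]
  have hside : ∀ s, side p q (f s) = s * N := fun s => by
    simp [hf, hm, hn, hN, side]; ring
  have hfc : Continuous f := by fun_prop
  have hmint : ∀ T, IsRange S T → p ∈ frontier T → q ∈ frontier T → m ∈ interior T :=
    fun T hT hp hq => hT.strictConvex hS (mem hT hp) (mem hT hq) hpq (by norm_num) (by norm_num)
      (by norm_num)
  have hshrink : ∀ T, IsRange S T → p ∈ frontier T → q ∈ frontier T → ∀ s t, 0 < s → s < t →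
      f t ∈ T → f s ∈ interior T := by
    intro T hT hp hq s t hs hst ht
    have := (hT.strictConvex hS).convex.combo_interior_self_mem_interior (hmint T hT hp hq) ht
      (a := 1 - s / t) (b := s / t)
      (by rw [sub_pos, div_lt_one (hs.trans hst)]; exact hst) (by have := hs.trans hst; positivity)
      (by ring)
    convert this using 1
    have ht0 : t ≠ 0 := (hs.trans hst).ne'
    simp only [hf, smul_add, smul_smul, div_mul_cancel₀ _ ht0, sub_smul, one_smul]
    abel
  have hthrough : ∀ t : ℝ, ∃ T, IsRange S T ∧ p ∈ frontier T ∧ q ∈ frontier T ∧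
      f (Real.exp t) ∈ frontier T := fun t =>
    hS.exists_range_through (by rw [hside]; have := Real.exp_pos t; positivity)
  choose P hP hPp hPq hPf using hthrough
  have hsurj : ∀ T, IsRange S T → p ∈ frontier T → q ∈ frontier T → ∃ t, T = P t := by
    intro T hT hp hq
    obtain ⟨B, hB⟩ := ((hT.isCompact hS).image (continuous_side p q)).bddAbove
    have hpre : IsPreconnected (f '' Ici 0) := isPreconnected_Ici.image _ hfc.continuousOn
    obtain ⟨x, ⟨s, hs, rfl⟩, hx⟩ := hpre.inter_frontier_nonempty (A := T)
      (hT.isCompact hS).isClosed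
      ⟨f 0, ⟨0, self_mem_Ici, rfl⟩, by simpa [hf] using interior_subset (hmint T hT hp hq)⟩
      ⟨f ((|B| + 1) / N), ⟨_, mem_Ici.2 (by positivity), rfl⟩, fun h => by
        have := hB ⟨_, h, rfl⟩
        rw [hside, div_mul_cancel₀ _ hNpos.ne'] at this
        linarith [le_abs_self B]⟩
    have hs0 : 0 < s := by
      refine lt_of_le_of_ne hs ?_
      rintro rfl
      exact hx.2 (by simpa [hf] using hmint T hT hp hq)
    refine ⟨Real.log s, hT.eq_of_frontier hS (hP _) (p := p) (q := q) (r := f s)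
      (by rw [hside]; positivity) hp hq hx (hPp _) (hPq _) ?_⟩
    simpa [Real.exp_log hs0] using hPf (Real.log s)
  have hthr : ∀ x, ∃ t, side p q x ≠ 0 → x ∈ frontier (P t) := by
    intro x
    by_cases hx : side p q x = 0
    · exact ⟨0, fun h => absurd hx h⟩
    · obtain ⟨T, hT, hp, hq, hr⟩ := hS.exists_range_through hx
      obtain ⟨t, rfl⟩ := hsurj T hT hp hq
      exact ⟨t, fun _ => hr⟩
  choose thr hthr using hthr
  have hlt : ∀ s t, s < t → (∀ u ∈ P s, 0 < side p q u → u ∈ interior (P t)) ∧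
      ∀ u ∈ P t, side p q u < 0 → u ∈ interior (P s) := by
    intro s t hst
    have hint : ∀ T, IsRange S T → p ∈ frontier T → q ∈ frontier T → f (Real.exp t) ∈ T →
        f (Real.exp s) ∈ interior T := fun T hT hp hq h =>
      hshrink T hT hp hq _ _ (Real.exp_pos s) (Real.exp_lt_exp.2 hst) h
    have hne : P s ≠ P t := fun h =>
      (hPf s).2 (hint _ (hP s) (hPp s) (hPq s) (by rw [h]; exact mem (hP t) (hPf t)))
    rcases (hP s).cap_dichotomy hS (hP t) hne hpq (hPp s) (hPq s) (hPp t) (hPq t) with h | h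
    · exact h
    · refine absurd (hint _ (hP s) (hPp s) (hPq s)
        (interior_subset (h.2 _ (mem (hP t) (hPf t)) ?_)))
        (hPf s).2
      rw [hside]; have := Real.exp_pos t; positivity
  exact ⟨P, thr, hP, hPp, hPq, hsurj, fun h => (hlt _ _ h).1 _, fun h => (hlt _ _ h).2 _, hthr⟩

namespace IsPencil

variable {S : Set Pt} {p q x : Pt} {P : ℝ → Set Pt} {thr : Pt → ℝ} {t : ℝ}

lemma thr_mem' (h : IsPencil S p q P thr) (hS : NiceShape S) (hx : side p q x ≠ 0) :
    x ∈ P (thr x) :=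
  (h.isRange _).mem_of_mem_frontier hS (h.thr_mem x hx)

lemma mem_iff_of_pos (h : IsPencil S p q P thr) (hS : NiceShape S) (hx : 0 < side p q x) :
    x ∈ P t ↔ thr x ≤ t := by
  refine ⟨fun hxt => ?_, fun ht => ?_⟩
  · by_contra! hlt
    exact (h.thr_mem x hx.ne').2 (h.pos_lt hlt hxt hx)
  · rcases ht.eq_or_lt with rfl | ht
    · exact h.thr_mem' hS hx.ne'
    · exact interior_subset (h.pos_lt ht (h.thr_mem' hS hx.ne') hx)

lemma mem_iff_of_neg (h : IsPencil S p q P thr) (hS : NiceShape S) (hx : side p q x < 0) :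
    x ∈ P t ↔ t ≤ thr x := by
  refine ⟨fun hxt => ?_, fun ht => ?_⟩
  · by_contra! hlt
    exact (h.thr_mem x hx.ne).2 (h.neg_lt hlt hxt hx)
  · rcases ht.eq_or_lt with rfl | ht
    · exact h.thr_mem' hS hx.ne
    · exact interior_subset (h.neg_lt ht (h.thr_mem' hS hx.ne) hx)

lemma mem_frontier_iff (h : IsPencil S p q P thr) (hS : NiceShape S) (hx : side p q x ≠ 0) :
    x ∈ frontier (P t) ↔ t = thr x := by
  refine ⟨fun hxt => ?_, fun ht => ht ▸ h.thr_mem x hx⟩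
  have hxm := (h.isRange t).mem_of_mem_frontier hS hxt
  rcases hx.lt_or_gt with hs | hs
  · refine ((h.mem_iff_of_neg hS hs).1 hxm).antisymm ?_
    by_contra! hlt
    exact hxt.2 (h.neg_lt hlt (h.thr_mem' hS hx) hs)
  · refine le_antisymm ?_ ((h.mem_iff_of_pos hS hs).1 hxm)
    by_contra! hlt
    exact hxt.2 (h.pos_lt hlt (h.thr_mem' hS hx) hs)

end IsPencil

lemma IsRange.eq_of_subset {S T T₀ : Set Pt} (hS : NiceShape S) (hT : IsRange S T)
    (hT₀ : IsRange S T₀) (hsub : T ⊆ T₀) {p q : Pt} (hpq : p ≠ q) (hpT : p ∈ T) (hqT : q ∈ T)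
    (hp : p ∈ frontier T₀) (hq : q ∈ frontier T₀) : T = T₀ := by
  have mem : ∀ {T x}, IsRange S T → x ∈ frontier T → x ∈ T := fun hT hx =>
    hT.mem_of_mem_frontier hS hx
  by_contra hne
  have hp' : p ∈ frontier T :=
    (hT.mem_frontier_iff hS).2 ⟨hpT, fun h => hp.2 (interior_mono hsub h)⟩
  have hq' : q ∈ frontier T :=
    (hT.mem_frontier_iff hS).2 ⟨hqT, fun h => hq.2 (interior_mono hsub h)⟩
  rcases hT.cap_dichotomy hS hT₀ hne hpq hp' hq' hp hq with ⟨-, h⟩ | ⟨-, h⟩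
  · obtain ⟨b, hb, hbs⟩ := hT₀.exists_frontier_side_neg hS hpq (mem hT₀ hp) (mem hT₀ hq)
    exact hb.2 (interior_mono hsub (h b (mem hT₀ hb) hbs))
  · obtain ⟨b, hb, hbs⟩ := hT₀.exists_frontier_side_neg hS hpq.symm (mem hT₀ hq) (mem hT₀ hp)
    rw [side_swap, neg_lt_zero] at hbs
    exact hb.2 (interior_mono hsub (h b (mem hT₀ hb) hbs))

lemma exists_side_pos_notMem {T : Set Pt} (hT : IsCompact T) {p q : Pt} (hpq : p ≠ q) :
    ∃ x, 0 < side p q x ∧ x ∉ T := by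
  obtain ⟨B, hB⟩ := (hT.image (continuous_side p q)).bddAbove
  set N : ℝ := (q 0 - p 0) ^ 2 + (q 1 - p 1) ^ 2 with hN
  have hNpos : 0 < N := by
    by_contra! hle
    apply hpq
    refine Pt.ext_coord ?_ ?_ <;> nlinarith [sq_nonneg (q 0 - p 0), sq_nonneg (q 1 - p 1)]
  have hside : side p q (p + ((|B| + 1) / N) • !₂[-(q 1 - p 1), q 0 - p 0]) = |B| + 1 := by
    have : side p q (p + ((|B| + 1) / N) • !₂[-(q 1 - p 1), q 0 - p 0]) = (|B| + 1) / N * N := by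
      simp [side, hN]; ring
    rw [this, div_mul_cancel₀ _ hNpos.ne']
  refine ⟨_, by rw [hside]; positivity, fun h => ?_⟩
  have := hB ⟨_, h, rfl⟩
  rw [hside] at this
  linarith [le_abs_self B]

lemma IsRange.subset_of_interior_inter_subset {S T T₀ : Set Pt} (hS : NiceShape S)
    (hT : IsRange S T) (hT₀ : IsClosed T₀) {U : Set Pt} (hU : IsOpen U)
    (hnt : T.Nontrivial) (h : ∀ u ∈ interior T, u ∈ U → u ∈ T₀) : ∀ u ∈ T, u ∈ U → u ∈ T₀ := by
  intro u hu huU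
  by_contra hu₀
  have hne : (interior T).Nonempty := by
    obtain ⟨x, hx, y, hy, hxy⟩ := hnt
    exact ⟨_, hT.strictConvex hS hx hy hxy one_half_pos one_half_pos (by norm_num)⟩
  have hcl : u ∈ closure (interior T) := by
    rw [(hT.strictConvex hS).convex.closure_interior_eq_closure_of_nonempty_interior hne]
    exact subset_closure hu
  obtain ⟨v, ⟨hv₀, hvU⟩, hv⟩ := mem_closure_iff.1 hcl (T₀ᶜ ∩ U) (hT₀.isOpen_compl.inter hU)
    ⟨hu₀, huU⟩
  exact hv₀ (h v hv hvU)

/-- Some member of a pencil is contained in a given range containing both base points. -/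
lemma IsPencil.exists_subset {S : Set Pt} {p q : Pt} {P : ℝ → Set Pt} {thr : Pt → ℝ}
    (h : IsPencil S p q P thr) (hS : NiceShape S) (hpq : p ≠ q) {T₀ : Set Pt}
    (hT₀ : IsRange S T₀) (hp : p ∈ T₀) (hq : q ∈ T₀) : ∃ s, P s ⊆ T₀ := by
  by_cases hex : ∃ s, P s = T₀
  · obtain ⟨s, hs⟩ := hex
    exact ⟨s, hs.subset⟩
  push Not at hex
  set A : Set ℝ := {s | ∀ u ∈ P s, 0 < side p q u → u ∈ T₀} with hA
  set B : Set ℝ := {s | ∀ u ∈ P s, side p q u < 0 → u ∈ T₀} with hB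
  have hAB : ∀ s, s ∈ A ∨ s ∈ B := fun s =>
    ((h.isRange s).cap_subset_interior hS hT₀ (hex s) hpq (h.left s) (h.right s) hp hq).imp
      (fun H u hu hs => interior_subset (H u hu hs)) fun H u hu hs => interior_subset (H u hu hs)
  obtain ⟨x, hx, hxT⟩ := exists_side_pos_notMem (hT₀.isCompact hS) hpq
  obtain ⟨y, hy, hyT⟩ := exists_side_pos_notMem (hT₀.isCompact hS) hpq.symm
  rw [side_swap, neg_pos] at hy
  have hAbdd : BddAbove A := ⟨thr x, fun s hs => by
    by_contra! hlt
    exact hxT (hs x ((h.mem_iff_of_pos hS hx).2 hlt.le) hx)⟩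
  have hAne : A.Nonempty := ⟨thr y - 1, (hAB _).resolve_right fun hs =>
    hyT (hs y ((h.mem_iff_of_neg hS hy).2 (by linarith)) hy)⟩
  set a := sSup A with ha
  have hnt : (P a).Nontrivial := ⟨p, (h.isRange a).mem_of_mem_frontier hS (h.left a), q,
    (h.isRange a).mem_of_mem_frontier hS (h.right a), hpq⟩
  have hcl : IsClosed T₀ := (hT₀.isCompact hS).isClosed
  have hpos := (h.isRange a).subset_of_interior_inter_subset hS hcl
    (isOpen_lt continuous_const (continuous_side p q)) hnt (fun u hu hus => by
      have hus' : 0 < side p q u := hus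
      have hle := (h.mem_iff_of_pos hS hus').1 (interior_subset hu)
      have hne : a ≠ thr u := fun hau =>
        ((h.mem_frontier_iff hS hus'.ne').2 hau).2 hu
      obtain ⟨s, hsA, hs⟩ := exists_lt_of_lt_csSup hAne (lt_of_le_of_ne hle hne.symm)
      exact hsA u ((h.mem_iff_of_pos hS hus').2 hs.le) hus')
  have hneg := (h.isRange a).subset_of_interior_inter_subset hS hcl
    (isOpen_lt (continuous_side p q) continuous_const) hnt (fun u hu hus => by
      have hus' : side p q u < 0 := hus
      have hle := (h.mem_iff_of_neg hS hus').1 (interior_subset hu)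
      have hne : a ≠ thr u := fun hau =>
        ((h.mem_frontier_iff hS hus'.ne).2 hau).2 hu
      have hB' := (hAB (thr u)).resolve_left fun hs =>
        (lt_of_le_of_ne hle hne).not_ge (le_csSup hAbdd hs)
      exact hB' u (h.thr_mem' hS hus'.ne) hus')
  refine ⟨a, fun u hu => ?_⟩
  rcases lt_trichotomy (side p q u) 0 with hs | hs | hs
  · exact hneg u hu hs
  · have hl := ((h.isRange a).mem_frontier_iff hS).1 (h.left a)
    have hr := ((h.isRange a).mem_frontier_iff hS).1 (h.right a)
    obtain ⟨r, hr0, hr1, rfl⟩ := mem_segment_of_side_eq_zero ((h.isRange a).strictConvex hS) hpq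
      hl.1 hr.1 hl.2 hr.2 hu hs
    exact (hT₀.strictConvex hS).convex.add_smul_sub_mem hp hq ⟨hr0, hr1⟩
  · exact hpos u hu hs

lemma IsRange.exists_rescale {S T : Set Pt} (hT : IsRange S T) (z : Pt) {s : ℝ} (hs : 0 < s) :
    ∃ T', IsRange S T' ∧ (∀ x, x ∈ T' ↔ z + s • (x - z) ∈ T) ∧
      ∀ x, x ∈ frontier T' ↔ z + s • (x - z) ∈ frontier T := by
  obtain ⟨c, v, hc, rfl⟩ := hT
  let h : Pt ≃ₜ Pt := (Homeomorph.smulOfNeZero s hs.ne').trans (Homeomorph.addRight (z - s • z))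
  have hh : ∀ x, h x = z + s • (x - z) := fun x => by
    change s • x + (z - s • z) = _
    rw [smul_sub]; abel
  refine ⟨h ⁻¹' ((fun x => c • x + v) '' S), ⟨s⁻¹ * c, s⁻¹ • (v - (z - s • z)), by positivity, ?_⟩,
    fun x => by rw [mem_preimage, hh], fun x => by rw [← h.preimage_frontier, mem_preimage, hh]⟩
  ext x
  simp only [mem_preimage, mem_image, hh]
  refine exists_congr fun y => and_congr_right fun _ => ?_
  constructor
  · intro hy
    have : v = z + s • (x - z) - c • y := by rw [← hy]; abel
    rw [this, ← sub_eq_zero]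
    simp only [smul_sub, smul_add, smul_smul, inv_mul_cancel₀ hs.ne', one_smul]
    abel
  · rintro rfl
    simp only [smul_sub, smul_add, smul_smul, mul_inv_cancel₀ hs.ne', mul_inv_cancel_left₀ hs.ne',
      one_smul]
    abel

/-- A range can be shrunk towards one of its points `z` until another point of a finite set hits
the boundary. -/
lemma IsRange.exists_shrink {S T : Set Pt} (hS : NiceShape S) (hT : IsRange S T) {z : Pt}
    (hz : z ∈ T) {Y : Finset Pt} (hY : (Y : Set Pt) ⊆ T) (hne : ∃ y ∈ Y, y ≠ z) :
    ∃ T', IsRange S T' ∧ T' ⊆ T ∧ (Y : Set Pt) ⊆ T' ∧ (z ∈ frontier T → z ∈ frontier T') ∧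
      ∃ y ∈ Y, y ≠ z ∧ y ∈ frontier T' := by
  classical
  have hmax : ∀ y : Pt, ∃ s : ℝ, y ∈ Y → y ≠ z → 1 ≤ s ∧ z + s • (y - z) ∈ frontier T := by
    intro y
    by_cases hy : y ∈ Y ∧ y ≠ z
    swap
    · exact ⟨0, fun h1 h2 => absurd ⟨h1, h2⟩ hy⟩
    have hpre : IsPreconnected ((fun s : ℝ => z + s • (y - z)) '' Ici 1) :=
      isPreconnected_Ici.image _ (by fun_prop)
    obtain ⟨R, hR⟩ := (hT.isCompact hS).isBounded.subset_closedBall z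
    have hpos : 0 < ‖y - z‖ := norm_pos_iff.2 (sub_ne_zero.2 hy.2)
    obtain ⟨-, ⟨s, hs, rfl⟩, hsf⟩ := hpre.inter_frontier_nonempty (A := T)
      (hT.isCompact hS).isClosed
      ⟨y, ⟨1, self_mem_Ici, by simp⟩, hY hy.1⟩
      ⟨_, ⟨max 1 ((|R| + 1) / ‖y - z‖), mem_Ici.2 (le_max_left _ _), rfl⟩,
        fun hmem => by
        have h1 := hR hmem
        rw [Metric.mem_closedBall, dist_eq_norm, add_sub_cancel_left, norm_smul, Real.norm_eq_abs,
          abs_of_pos (lt_max_of_lt_left one_pos)] at h1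
        have h2 := mul_le_mul_of_nonneg_right (le_max_right 1 ((|R| + 1) / ‖y - z‖)) hpos.le
        rw [div_mul_cancel₀ _ hpos.ne'] at h2
        linarith [le_abs_self R]⟩
    exact ⟨s, fun _ _ => ⟨hs, hsf⟩⟩
  choose s hs using hmax
  obtain ⟨y, hy, hmin⟩ := (Y.filter (· ≠ z)).exists_min_image s (by
    obtain ⟨y, hy, hyz⟩ := hne
    exact ⟨y, Finset.mem_filter.2 ⟨hy, hyz⟩⟩)
  rw [Finset.mem_filter] at hy
  obtain ⟨h1, hyf⟩ := hs y hy.1 hy.2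
  have hs0 : 0 < s y := by linarith
  have hconv := (hT.strictConvex hS).convex
  obtain ⟨T', hT', hmem, hfr⟩ := hT.exists_rescale z hs0
  have hsub : T' ⊆ T := fun x hx => by
    have := hconv.add_smul_sub_mem hz ((hmem x).1 hx) (t := (s y)⁻¹)
      ⟨by positivity, inv_le_one_of_one_le₀ h1⟩
    rwa [add_sub_cancel_left, smul_smul, inv_mul_cancel₀ hs0.ne', one_smul,
      add_sub_cancel] at this
  have hzT' : z ∈ T' := (hmem z).2 (by simpa using hz)
  refine ⟨T', hT', hsub, fun x hx => ?_, fun hzf => (hT'.mem_frontier_iff hS).2 ⟨hzT', fun hi =>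
    hzf.2 (interior_mono hsub hi)⟩, y, hy.1, hy.2, (hfr y).2 hyf⟩
  by_cases hxz : x = z
  · rwa [hxz]
  · obtain ⟨hx1, hxf⟩ := hs x hx hxz
    have hle : s y ≤ s x := hmin x (Finset.mem_filter.2 ⟨hx, hxz⟩)
    rw [hmem]
    have := hconv.add_smul_sub_mem hz (hT.mem_of_mem_frontier hS hxf) (t := s y / s x)
      ⟨by positivity, div_le_one_of_le₀ hle (by linarith)⟩
    rwa [add_sub_cancel_left, smul_smul, div_mul_cancel₀ _ (by linarith : s x ≠ 0)] at this

lemma IsRange.exists_shrink_two {S T : Set Pt} (hS : NiceShape S) (hT : IsRange S T)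
    {Y : Finset Pt} (hY : (Y : Set Pt) ⊆ T) (hcard : 2 ≤ Y.card) :
    ∃ T', IsRange S T' ∧ T' ⊆ T ∧ (Y : Set Pt) ⊆ T' ∧
      ∃ p ∈ Y, ∃ q ∈ Y, p ≠ q ∧ p ∈ frontier T' ∧ q ∈ frontier T' := by
  obtain ⟨z, hz, y, hy, hzy⟩ := Finset.one_lt_card.1 hcard
  obtain ⟨T₁, hT₁, hsub₁, hY₁, -, p, hp, -, hpf⟩ := hT.exists_shrink hS (hY hz) hY ⟨y, hy, hzy.symm⟩
  obtain ⟨T₂, hT₂, hsub₂, hY₂, hpf₂, q, hq, hqp, hqf⟩ := hT₁.exists_shrink hS (hY₁ hp) hY₁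
    (Finset.exists_mem_ne hcard p)
  exact ⟨T₂, hT₂, hsub₂.trans hsub₁, hY₂, p, hp, q, hq, hqp.symm, hpf₂ hpf, hqf⟩

open scoped Classical in
/-- The points of `X` in `T`. -/
def capt (X : Finset Pt) (T : Set Pt) : Finset Pt := X.filter (· ∈ T)

open scoped Classical in
/-- The points of `X` on the boundary of `T`. -/
def bdry (X : Finset Pt) (T : Set Pt) : Finset Pt := X.filter (· ∈ frontier T)

lemma mem_capt {X : Finset Pt} {T : Set Pt} {x : Pt} : x ∈ capt X T ↔ x ∈ X ∧ x ∈ T := by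
  simp [capt]

lemma mem_bdry {X : Finset Pt} {T : Set Pt} {x : Pt} :
    x ∈ bdry X T ↔ x ∈ X ∧ x ∈ frontier T := by
  simp [bdry]

lemma coe_capt (X : Finset Pt) (T : Set Pt) : (capt X T : Set Pt) = ↑X ∩ T := by
  ext x; simp [mem_capt]

lemma coe_bdry (X : Finset Pt) (T : Set Pt) : (bdry X T : Set Pt) = ↑X ∩ frontier T := by
  ext x; simp [mem_bdry]

lemma GenPos.side_ne_zero {S : Set Pt} {X : Finset Pt} (hX : GenPos S X) {p q r : Pt} (hp : p ∈ X)
    (hq : q ∈ X) (hr : r ∈ X) (hpq : p ≠ q) (hpr : p ≠ r) (hqr : q ≠ r) : side p q r ≠ 0 := by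
  intro h
  refine hX.2.1 p hp q hq r hr hpq hpr hqr ?_
  have hcr : crossWith (q - p) (r - p) = 0 := by
    rw [crossWith_apply]; simpa [side] using h
  obtain ⟨t, ht⟩ := exists_smul_of_crossWith_eq_zero (sub_ne_zero.2 hpq.symm) hcr
  rw [collinear_iff_of_mem (p₀ := p) (by simp)]
  refine ⟨q - p, ?_⟩
  rintro x (rfl | rfl | rfl)
  · exact ⟨0, by simp⟩
  · exact ⟨1, by simp⟩
  · exact ⟨t, by simp [← ht]⟩

lemma ne_of_side_ne_zero {p q r : Pt} (h : side p q r ≠ 0) : p ≠ q ∧ p ≠ r ∧ q ≠ r := by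
  refine ⟨?_, ?_, ?_⟩ <;> rintro rfl <;> exact h (by simp only [side]; ring)

lemma GenPos.bdry_eq {S : Set Pt} {X : Finset Pt} (hX : GenPos S X) {T : Set Pt}
    (hT : IsRange S T) {p q r : Pt} (hp : p ∈ bdry X T) (hq : q ∈ bdry X T) (hr : r ∈ bdry X T)
    (hpq : p ≠ q) (hpr : p ≠ r) (hqr : q ≠ r) : bdry X T = {p, q, r} := by
  ext x
  constructor
  · intro hx
    by_contra hne
    simp only [Finset.mem_insert, Finset.mem_singleton, not_or] at hne
    rw [mem_bdry] at hp hq hr hx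
    exact hX.2.2 T hT p q r x hp hq hr hx hpq hpr (Ne.symm hne.1) hqr (Ne.symm hne.2.1)
      (Ne.symm hne.2.2)
  · intro hx
    simp only [Finset.mem_insert, Finset.mem_singleton] at hx
    rcases hx with rfl | rfl | rfl <;> assumption

open scoped Classical in
/-- The range through three non-collinear points. -/
def circ (S : Set Pt) (p q r : Pt) : Set Pt :=
  if h : ∃ T, IsRange S T ∧ p ∈ frontier T ∧ q ∈ frontier T ∧ r ∈ frontier T then h.choose else ∅

lemma circ_spec {S : Set Pt} (hS : NiceShape S) {p q r : Pt} (h : side p q r ≠ 0) :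
    IsRange S (circ S p q r) ∧ p ∈ frontier (circ S p q r) ∧ q ∈ frontier (circ S p q r) ∧
      r ∈ frontier (circ S p q r) := by
  have hex := hS.exists_range_through h
  rw [circ, dif_pos hex]
  exact hex.choose_spec

lemma circ_eq {S T : Set Pt} (hS : NiceShape S) (hT : IsRange S T) {p q r : Pt}
    (h : side p q r ≠ 0) (hp : p ∈ frontier T) (hq : q ∈ frontier T) (hr : r ∈ frontier T) :
    circ S p q r = T := by
  obtain ⟨h1, h2, h3, h4⟩ := circ_spec hS h
  exact h1.eq_of_frontier hS hT h h2 h3 h4 hp hq hr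

lemma bdry_circ {S : Set Pt} (hS : NiceShape S) {X : Finset Pt} (hX : GenPos S X) {p q r : Pt}
    (hp : p ∈ X) (hq : q ∈ X) (hr : r ∈ X) (h : side p q r ≠ 0) :
    bdry X (circ S p q r) = {p, q, r} := by
  obtain ⟨h1, h2, h3, h4⟩ := circ_spec hS h
  obtain ⟨hpq, hpr, hqr⟩ := ne_of_side_ne_zero h
  exact hX.bdry_eq h1 (mem_bdry.2 ⟨hp, h2⟩) (mem_bdry.2 ⟨hq, h3⟩) (mem_bdry.2 ⟨hr, h4⟩) hpq hpr hqr

open scoped Classical in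
/-- The points of `X` on the nonnegative side of the line `p q`. -/
def halfSet (X : Finset Pt) (p q : Pt) : Finset Pt := X.filter (0 ≤ side p q ·)

open scoped Classical in
/-- The points of `X` in the ranges preceding `circ S p q z` in the pencil of `p q`. -/
def gapSet (S : Set Pt) (X : Finset Pt) (p q z : Pt) : Finset Pt :=
  if 0 < side p q z then (capt X (circ S p q z)).erase z else capt X (circ S p q z)

lemma gapSet_subset {S : Set Pt} {X : Finset Pt} {p q z : Pt} : gapSet S X p q z ⊆ X := by
  intro x hx
  rw [gapSet] at hx
  split_ifs at hx
  · exact (mem_capt.1 (Finset.mem_of_mem_erase hx)).1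
  · exact (mem_capt.1 hx).1

lemma exists_lt_gap (F : Finset ℝ) (a : ℝ) : ∃ t < a, ∀ b ∈ F, b < a → b < t := by
  classical
  by_cases hne : (F.filter (· < a)).Nonempty
  · have hm := Finset.mem_filter.1 ((F.filter (· < a)).max'_mem hne)
    obtain ⟨t, h1, h2⟩ := exists_between hm.2
    exact ⟨t, h2, fun b hb hba => ((F.filter (· < a)).le_max' b
      (Finset.mem_filter.2 ⟨hb, hba⟩)).trans_lt h1⟩
  · refine ⟨a - 1, by linarith, fun b hb hba => absurd ⟨b, Finset.mem_filter.2 ⟨hb, hba⟩⟩ hne⟩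

namespace IsPencil

variable {S : Set Pt} {X : Finset Pt} {p q x z : Pt} {P : ℝ → Set Pt} {thr : Pt → ℝ} {t : ℝ}

lemma side_pos_or_neg (hX : GenPos S X) (hp : p ∈ X) (hq : q ∈ X) (hpq : p ≠ q) (hx : x ∈ X) :
    x = p ∨ x = q ∨ 0 < side p q x ∨ side p q x < 0 := by
  by_cases h1 : x = p
  · exact Or.inl h1
  by_cases h2 : x = q
  · exact Or.inr (Or.inl h2)
  have := hX.side_ne_zero hp hq hx hpq (Ne.symm h1) (Ne.symm h2)
  rcases this.lt_or_gt with h | h <;> simp [h]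

lemma circ_eq (h : IsPencil S p q P thr) (hS : NiceShape S) (hz : side p q z ≠ 0) :
    circ S p q z = P (thr z) :=
  _root_.circ_eq hS (h.isRange _) hz (h.left _) (h.right _) (h.thr_mem z hz)

lemma left_mem (h : IsPencil S p q P thr) (hS : NiceShape S) (t : ℝ) : p ∈ P t :=
  (h.isRange t).mem_of_mem_frontier hS (h.left t)

lemma right_mem (h : IsPencil S p q P thr) (hS : NiceShape S) (t : ℝ) : q ∈ P t :=
  (h.isRange t).mem_of_mem_frontier hS (h.right t)

lemma mem_capt_iff (h : IsPencil S p q P thr) (hS : NiceShape S) (hX : GenPos S X) (hp : p ∈ X)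
    (hq : q ∈ X) (hpq : p ≠ q) (hx : x ∈ X) :
    x ∈ capt X (P t) ↔
      x = p ∨ x = q ∨ (0 < side p q x ∧ thr x ≤ t) ∨ (side p q x < 0 ∧ t ≤ thr x) := by
  rw [mem_capt, and_iff_right hx]
  rcases side_pos_or_neg hX hp hq hpq hx with rfl | rfl | hs | hs
  · simp [h.left_mem hS]
  · simp [h.right_mem hS]
  · have h1 := (ne_of_side_ne_zero hs.ne').2
    simp [h.mem_iff_of_pos hS hs, hs, hs.le, h1.1.symm, h1.2.symm]
  · have h1 := (ne_of_side_ne_zero hs.ne).2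
    simp [h.mem_iff_of_neg hS hs, hs, hs.le, h1.1.symm, h1.2.symm]

lemma thr_injective (h : IsPencil S p q P thr) (hX : GenPos S X) (hp : p ∈ X)
    (hq : q ∈ X) (hx : x ∈ X) (hz : z ∈ X) (hxs : side p q x ≠ 0)
    (hzs : side p q z ≠ 0) (heq : thr x = thr z) : x = z := by
  by_contra hne
  obtain ⟨hpq, hpx, hqx⟩ := ne_of_side_ne_zero hxs
  obtain ⟨-, hpz, hqz⟩ := ne_of_side_ne_zero hzs
  exact hX.2.2 _ (h.isRange (thr x)) p q x z ⟨hp, h.left _⟩ ⟨hq, h.right _⟩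
    ⟨hx, h.thr_mem x hxs⟩ ⟨hz, heq ▸ h.thr_mem z hzs⟩ hpq hpx hpz hqx hqz hne

lemma mem_gapSet_iff (h : IsPencil S p q P thr) (hS : NiceShape S) (hX : GenPos S X) (hp : p ∈ X)
    (hq : q ∈ X) (hpq : p ≠ q) (hx : x ∈ X) (hz : z ∈ X) (hzs : side p q z ≠ 0) :
    x ∈ gapSet S X p q z ↔
      x = p ∨ x = q ∨ (0 < side p q x ∧ thr x < thr z) ∨ (side p q x < 0 ∧ thr z ≤ thr x) := by
  obtain ⟨-, hpz, hqz⟩ := ne_of_side_ne_zero hzs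
  have hlt : ∀ x ∈ X, 0 < side p q x → (thr x < thr z ↔ thr x ≤ thr z ∧ x ≠ z) := by
    intro x hx hxs
    rw [lt_iff_le_and_ne]
    refine and_congr_right fun _ => not_congr ⟨h.thr_injective hX hp hq hx hz hxs.ne' hzs, ?_⟩
    rintro rfl; rfl
  rw [gapSet, h.circ_eq hS hzs]
  split_ifs with hpos
  · rw [Finset.mem_erase, h.mem_capt_iff hS hX hp hq hpq hx]
    constructor
    · rintro ⟨hxz, rfl | rfl | ⟨h1, h2⟩ | h1⟩
      · simp
      · simp
      · exact Or.inr (Or.inr (Or.inl ⟨h1, (hlt x hx h1).2 ⟨h2, hxz⟩⟩))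
      · exact Or.inr (Or.inr (Or.inr h1))
    · rintro (rfl | rfl | ⟨h1, h2⟩ | h1)
      · exact ⟨hpz, by simp⟩
      · exact ⟨hqz, by simp⟩
      · have := (hlt x hx h1).1 h2
        exact ⟨this.2, Or.inr (Or.inr (Or.inl ⟨h1, this.1⟩))⟩
      · exact ⟨by rintro rfl; exact lt_asymm hpos h1.1, Or.inr (Or.inr (Or.inr h1))⟩
  · rw [h.mem_capt_iff hS hX hp hq hpq hx]
    refine or_congr_right (or_congr_right (or_congr_left (and_congr_right fun h1 => ?_)))
    rw [hlt x hx h1]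
    exact ⟨fun h2 => ⟨h2, by rintro rfl; exact hpos h1⟩, fun h2 => h2.1⟩

lemma bdry_eq_pair (h : IsPencil S p q P thr) (hS : NiceShape S) (hX : GenPos S X) (hp : p ∈ X)
    (hq : q ∈ X) (hpq : p ≠ q) (ht : ∀ x ∈ X, side p q x ≠ 0 → t ≠ thr x) :
    bdry X (P t) = {p, q} := by
  ext x
  rw [mem_bdry, Finset.mem_insert, Finset.mem_singleton]
  constructor
  · rintro ⟨hx, hxf⟩
    rcases side_pos_or_neg hX hp hq hpq hx with hs | hs | hs | hs
    · exact Or.inl hs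
    · exact Or.inr hs
    · exact absurd ((h.mem_frontier_iff hS hs.ne').1 hxf) (ht x hx hs.ne')
    · exact absurd ((h.mem_frontier_iff hS hs.ne).1 hxf) (ht x hx hs.ne)
  · rintro (rfl | rfl)
    · exact ⟨hp, h.left t⟩
    · exact ⟨hq, h.right t⟩

lemma exists_capt_eq_gapSet (h : IsPencil S p q P thr) (hS : NiceShape S) (hX : GenPos S X)
    (hp : p ∈ X) (hq : q ∈ X) (hpq : p ≠ q) (hz : z ∈ X) (hzs : side p q z ≠ 0) :
    ∃ t, capt X (P t) = gapSet S X p q z ∧ bdry X (P t) = {p, q} := by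
  classical
  obtain ⟨t, ht, hgap⟩ := exists_lt_gap (X.image thr) (thr z)
  have hgap' : ∀ x ∈ X, thr x < thr z → thr x < t := fun x hx =>
    hgap _ (Finset.mem_image_of_mem thr hx)
  refine ⟨t, ?_, h.bdry_eq_pair hS hX hp hq hpq fun x hx hxs heq => ?_⟩
  · ext x
    by_cases hx : x ∈ X
    · rw [h.mem_capt_iff hS hX hp hq hpq hx, h.mem_gapSet_iff hS hX hp hq hpq hx hz hzs]
      refine or_congr_right (or_congr_right (or_congr (and_congr_right fun _ =>
        ⟨fun h1 => h1.trans_lt ht, fun h1 => (hgap' x hx h1).le⟩) (and_congr_right fun _ =>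
        ⟨fun h1 => ?_, fun h1 => ht.le.trans h1⟩)))
      by_contra! h2
      exact (hgap' x hx h2).not_ge h1
    · exact iff_of_false (fun h1 => hx (mem_capt.1 h1).1) fun h1 => hx (gapSet_subset h1)
  · have := hgap' x hx (heq ▸ ht)
    exact this.ne heq.symm

lemma mem_halfSet_iff (hX : GenPos S X) (hp : p ∈ X) (hq : q ∈ X) (hpq : p ≠ q) (hx : x ∈ X) :
    x ∈ halfSet X p q ↔ x = p ∨ x = q ∨ 0 < side p q x := by
  rw [halfSet, Finset.mem_filter, and_iff_right hx]
  rcases side_pos_or_neg hX hp hq hpq hx with rfl | rfl | hs | hs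
  · simp
  · simp
  · simp [hs, hs.le]
  · have h1 := (ne_of_side_ne_zero hs.ne).2
    simp [hs.not_ge, hs.not_gt, h1.1.symm, h1.2.symm]

lemma capt_eq_halfSet (h : IsPencil S p q P thr) (hS : NiceShape S) (hX : GenPos S X)
    (hp : p ∈ X) (hq : q ∈ X) (hpq : p ≠ q) (ht : ∀ x ∈ X, side p q x ≠ 0 → thr x < t) :
    capt X (P t) = halfSet X p q := by
  ext x
  by_cases hx : x ∈ X
  · rw [h.mem_capt_iff hS hX hp hq hpq hx, mem_halfSet_iff hX hp hq hpq hx]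
    refine or_congr_right (or_congr_right ⟨?_, fun h1 => Or.inl ⟨h1, (ht x hx h1.ne').le⟩⟩)
    rintro (h1 | h1)
    · exact h1.1
    · exact absurd h1.2 (ht x hx h1.1.ne).not_ge
  · exact iff_of_false (fun h1 => hx (mem_capt.1 h1).1) fun h1 => hx (Finset.mem_filter.1 h1).1

lemma exists_capt_eq_halfSet (h : IsPencil S p q P thr) (hS : NiceShape S) (hX : GenPos S X)
    (hp : p ∈ X) (hq : q ∈ X) (hpq : p ≠ q) :
    ∃ t, capt X (P t) = halfSet X p q ∧ bdry X (P t) = {p, q} := by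
  classical
  obtain ⟨B, hB⟩ := (X.image thr).bddAbove
  have hB' : ∀ x ∈ X, thr x < B + 1 := fun x hx => by
    have := hB (Finset.mem_coe.2 (Finset.mem_image_of_mem thr hx)); linarith
  exact ⟨B + 1, h.capt_eq_halfSet hS hX hp hq hpq fun x hx _ => hB' x hx,
    h.bdry_eq_pair hS hX hp hq hpq fun x hx _ => (hB' x hx).ne'⟩

lemma capt_eq_halfSet_or_gapSet (h : IsPencil S p q P thr) (hS : NiceShape S) (hX : GenPos S X)
    (hp : p ∈ X) (hq : q ∈ X) (hpq : p ≠ q) (hb : bdry X (P t) = {p, q}) :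
    capt X (P t) = halfSet X p q ∨
      ∃ z ∈ X, side p q z ≠ 0 ∧ capt X (P t) = gapSet S X p q z := by
  classical
  have hgen : ∀ x ∈ X, side p q x ≠ 0 → t ≠ thr x := by
    intro x hx hxs heq
    have hxb : x ∈ bdry X (P t) := mem_bdry.2 ⟨hx, (h.mem_frontier_iff hS hxs).2 heq⟩
    obtain ⟨-, h1, h2⟩ := ne_of_side_ne_zero hxs
    rw [hb] at hxb
    simp [h1.symm, h2.symm] at hxb
  set F := X.filter fun x => side p q x ≠ 0 ∧ t < thr x with hF
  by_cases hne : F.Nonempty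
  · right
    obtain ⟨z, hzF, hmin⟩ := F.exists_min_image thr hne
    obtain ⟨hz, hzs, htz⟩ := Finset.mem_filter.1 hzF
    refine ⟨z, hz, hzs, ?_⟩
    have hkey : ∀ x ∈ X, side p q x ≠ 0 → (t < thr x ↔ thr z ≤ thr x) := fun x hx hxs =>
      ⟨fun h1 => hmin x (Finset.mem_filter.2 ⟨hx, hxs, h1⟩), fun h1 => htz.trans_le h1⟩
    ext x
    by_cases hx : x ∈ X
    · rw [h.mem_capt_iff hS hX hp hq hpq hx, h.mem_gapSet_iff hS hX hp hq hpq hx hz hzs]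
      refine or_congr_right (or_congr_right (or_congr (and_congr_right fun h1 => ?_)
        (and_congr_right fun h1 => ?_)))
      · rw [← not_lt, hkey x hx h1.ne', not_le]
      · rw [← hkey x hx h1.ne]
        exact ⟨fun h2 => lt_of_le_of_ne h2 (hgen x hx h1.ne), le_of_lt⟩
    · exact iff_of_false (fun h1 => hx (mem_capt.1 h1).1) fun h1 => hx (gapSet_subset h1)
  · left
    refine h.capt_eq_halfSet hS hX hp hq hpq fun x hx hxs => ?_
    refine lt_of_le_of_ne ?_ (hgen x hx hxs).symm
    by_contra! hlt
    exact hne ⟨x, Finset.mem_filter.2 ⟨hx, hxs, hlt⟩⟩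

lemma gapSet_injective (h : IsPencil S p q P thr) (hS : NiceShape S) (hX : GenPos S X)
    (hp : p ∈ X) (hq : q ∈ X) (hpq : p ≠ q) (hx : x ∈ X) (hxs : side p q x ≠ 0) (hz : z ∈ X)
    (hzs : side p q z ≠ 0) (heq : gapSet S X p q x = gapSet S X p q z) : x = z := by
  by_contra hne
  wlog hlt : thr x < thr z generalizing x z
  · refine this hz hzs hx hxs heq.symm (Ne.symm hne)
      (lt_of_le_of_ne (not_lt.1 hlt) fun h1 => hne ?_)
    exact h.thr_injective hX hp hq hx hz hxs hzs h1.symm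
  have h1 : x ∈ gapSet S X p q x ↔ x ∈ gapSet S X p q z := by rw [heq]
  rw [h.mem_gapSet_iff hS hX hp hq hpq hx hx hxs, h.mem_gapSet_iff hS hX hp hq hpq hx hz hzs] at h1
  obtain ⟨-, h2, h3⟩ := ne_of_side_ne_zero hxs
  rcases hxs.lt_or_gt with hs | hs
  · simp [h2.symm, h3.symm, hs, hs.not_gt] at h1
    exact h1.not_gt hlt
  · simp [h2.symm, h3.symm, hs, hs.not_gt, hlt] at h1

lemma gapSet_ne_halfSet (h : IsPencil S p q P thr) (hS : NiceShape S) (hX : GenPos S X)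
    (hp : p ∈ X) (hq : q ∈ X) (hpq : p ≠ q) (hz : z ∈ X)
    (hzs : side p q z ≠ 0) : gapSet S X p q z ≠ halfSet X p q := by
  intro heq
  have h1 : z ∈ gapSet S X p q z ↔ z ∈ halfSet X p q := by rw [heq]
  rw [h.mem_gapSet_iff hS hX hp hq hpq hz hz hzs, mem_halfSet_iff hX hp hq hpq hz] at h1
  obtain ⟨-, h2, h3⟩ := ne_of_side_ne_zero hzs
  rcases hzs.lt_or_gt with hs | hs <;> simp [h2.symm, h3.symm, hs, hs.not_gt] at h1

end IsPencil

/-- `Y` is captured by a range whose boundary meets `X` exactly in `p` and `q`. -/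
def Generic (S : Set Pt) (X Y : Finset Pt) (p q : Pt) : Prop :=
  ∃ T, IsRange S T ∧ capt X T = Y ∧ bdry X T = {p, q}

lemma Generic.swap {S : Set Pt} {X Y : Finset Pt} {p q : Pt} (h : Generic S X Y p q) :
    Generic S X Y q p := by
  obtain ⟨T, hT, hc, hb⟩ := h
  exact ⟨T, hT, hc, by rw [hb, Finset.pair_comm]⟩

lemma generic_iff {S : Set Pt} (hS : NiceShape S) {X : Finset Pt} (hX : GenPos S X) {p q : Pt}
    (hp : p ∈ X) (hq : q ∈ X) (hpq : p ≠ q) {Y : Finset Pt} :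
    Generic S X Y p q ↔
      Y = halfSet X p q ∨ ∃ z ∈ X, side p q z ≠ 0 ∧ Y = gapSet S X p q z := by
  obtain ⟨P, thr, h⟩ := exists_isPencil hS hpq
  constructor
  · rintro ⟨T, hT, rfl, hb⟩
    have hpT : p ∈ bdry X T := by simp [hb]
    have hqT : q ∈ bdry X T := by simp [hb]
    obtain ⟨t, rfl⟩ := h.exists_eq T hT (mem_bdry.1 hpT).2 (mem_bdry.1 hqT).2
    exact h.capt_eq_halfSet_or_gapSet hS hX hp hq hpq hb
  · rintro (rfl | ⟨z, hz, hzs, rfl⟩)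
    · obtain ⟨t, h1, h2⟩ := h.exists_capt_eq_halfSet hS hX hp hq hpq
      exact ⟨P t, h.isRange t, h1, h2⟩
    · obtain ⟨t, h1, h2⟩ := h.exists_capt_eq_gapSet hS hX hp hq hpq hz hzs
      exact ⟨P t, h.isRange t, h1, h2⟩

lemma gapSet_of_neg {S : Set Pt} {X : Finset Pt} {p q z : Pt} (hs : side p q z < 0) :
    gapSet S X p q z = capt X (circ S p q z) := if_neg hs.not_gt

lemma card_gapSet_of_pos {S : Set Pt} (hS : NiceShape S) {X : Finset Pt} {p q z : Pt}
    (hz : z ∈ X) (hs : 0 < side p q z) :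
    (gapSet S X p q z).card + 1 = (capt X (circ S p q z)).card := by
  rw [gapSet, if_pos hs]
  obtain ⟨h1, -, -, h2⟩ := circ_spec hS hs.ne'
  exact Finset.card_erase_add_one (mem_capt.2 ⟨hz, h1.mem_of_mem_frontier hS h2⟩)

open scoped Classical in
lemma card_generic {S : Set Pt} (hS : NiceShape S) {X : Finset Pt} (hX : GenPos S X) {p q : Pt}
    (hp : p ∈ X) (hq : q ∈ X) (hpq : p ≠ q) (k : ℕ) :
    ((X.powersetCard k).filter fun Y => Generic S X Y p q).card =
      (X.filter fun z => side p q z < 0 ∧ (capt X (circ S p q z)).card = k).card +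
      (X.filter fun z => 0 < side p q z ∧ (capt X (circ S p q z)).card = k + 1).card +
      if (halfSet X p q).card = k then 1 else 0 := by
  obtain ⟨P, thr, h⟩ := exists_isPencil hS hpq
  set Z₁ := X.filter fun z => side p q z < 0 ∧ (capt X (circ S p q z)).card = k with hZ₁
  set Z₂ := X.filter fun z => 0 < side p q z ∧ (capt X (circ S p q z)).card = k + 1 with hZ₂
  have hmem : ∀ z, z ∈ Z₁ ∪ Z₂ ↔ z ∈ X ∧ side p q z ≠ 0 ∧ (gapSet S X p q z).card = k := by
    intro z
    rw [Finset.mem_union, hZ₁, hZ₂, Finset.mem_filter, Finset.mem_filter, ← and_or_left]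
    refine and_congr_right fun hz => ?_
    rcases lt_trichotomy (side p q z) 0 with hs | hs | hs
    · simp [hs, hs.not_gt, hs.ne, gapSet_of_neg hs]
    · simp [hs]
    · have := card_gapSet_of_pos hS hz hs
      simp only [hs, hs.not_gt, hs.ne', false_and, true_and, false_or, ne_eq, not_false_eq_true]
      omega
  have hdisj : Disjoint Z₁ Z₂ := by
    rw [Finset.disjoint_left]
    intro z h1 h2
    exact lt_asymm (Finset.mem_filter.1 h1).2.1 (Finset.mem_filter.1 h2).2.1
  have hset : ((X.powersetCard k).filter fun Y => Generic S X Y p q) =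
      ((Z₁ ∪ Z₂).image fun z => gapSet S X p q z) ∪
        if (halfSet X p q).card = k then {halfSet X p q} else ∅ := by
    ext Y
    rw [Finset.mem_union, Finset.mem_image, Finset.mem_filter, Finset.mem_powersetCard,
      generic_iff hS hX hp hq hpq]
    simp only [hmem]
    constructor
    · rintro ⟨⟨hY, hYk⟩, rfl | ⟨z, hz, hzs, rfl⟩⟩
      · right; rw [if_pos hYk]; exact Finset.mem_singleton_self _
      · exact Or.inl ⟨z, ⟨hz, hzs, hYk⟩, rfl⟩
    · rintro (⟨z, ⟨hz, hzs, hk⟩, rfl⟩ | hY)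
      · exact ⟨⟨gapSet_subset, hk⟩, Or.inr ⟨z, hz, hzs, rfl⟩⟩
      · split_ifs at hY with hk
        · rw [Finset.mem_singleton] at hY
          subst hY
          exact ⟨⟨Finset.filter_subset _ _, hk⟩, Or.inl rfl⟩
        · simp at hY
  rw [hset, Finset.card_union_of_disjoint, Finset.card_image_of_injOn,
    Finset.card_union_of_disjoint hdisj]
  · congr 1
    split_ifs <;> simp
  · intro z hz w hw heq
    obtain ⟨hz, hzs, -⟩ := (hmem z).1 hz
    obtain ⟨hw, hws, -⟩ := (hmem w).1 hw
    exact h.gapSet_injective hS hX hp hq hpq hz hzs hw hws heq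
  · rw [Finset.disjoint_left]
    rintro _ hY hY'
    obtain ⟨z, hz, rfl⟩ := Finset.mem_image.1 hY
    obtain ⟨hz, hzs, -⟩ := (hmem z).1 hz
    split_ifs at hY'
    · exact h.gapSet_ne_halfSet hS hX hp hq hpq hz hzs (Finset.mem_singleton.1 hY')
    · simp at hY'

lemma GenPos.exists_triple {S : Set Pt} {X : Finset Pt} (hX : GenPos S X) {T : Set Pt}
    (hT : (bdry X T).card = 3) {σ : ℝ} (hσ : σ ≠ 0) :
    ∃ a ∈ X, ∃ b ∈ X, ∃ c ∈ X, 0 < σ * side a b c ∧ bdry X T = {a, b, c} := by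
  obtain ⟨a, b, c, hab, hac, hbc, hb⟩ := Finset.card_eq_three.1 hT
  have haX : a ∈ X := (mem_bdry.1 (show a ∈ bdry X T by simp [hb])).1
  have hbX : b ∈ X := (mem_bdry.1 (show b ∈ bdry X T by simp [hb])).1
  have hcX : c ∈ X := (mem_bdry.1 (show c ∈ bdry X T by simp [hb])).1
  have hne : σ * side a b c ≠ 0 := mul_ne_zero hσ (hX.side_ne_zero haX hbX hcX hab hac hbc)
  rcases hne.lt_or_gt with h | h
  · exact ⟨b, hbX, a, haX, c, hcX, by rw [side_swap]; linarith, by rw [hb, Finset.insert_comm]⟩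
  · exact ⟨a, haX, b, hbX, c, hcX, h, hb⟩

lemma eq_cyclic_of_mem {a b c p q r : Pt} {σ : ℝ} (h : 0 < σ * side a b c)
    (h' : 0 < σ * side p q r) (hp : p ∈ ({a, b, c} : Finset Pt)) (hq : q ∈ ({a, b, c} : Finset Pt))
    (hr : r ∈ ({a, b, c} : Finset Pt)) :
    (p, q, r) = (a, b, c) ∨ (p, q, r) = (b, c, a) ∨ (p, q, r) = (c, a, b) := by
  obtain ⟨hpq, hpr, hqr⟩ := ne_of_side_ne_zero (right_ne_zero_of_mul h'.ne')
  have hodd : ¬ 0 < σ * side b a c := by rw [side_swap]; linarith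
  have hodd' : ¬ 0 < σ * side a c b := by rw [← side_rotate, side_swap, side_rotate] ; linarith
  have hodd'' : ¬ 0 < σ * side c b a := by rw [side_swap, side_rotate]; linarith
  simp only [Finset.mem_insert, Finset.mem_singleton] at hp hq hr
  rcases hp with rfl | rfl | rfl <;> rcases hq with rfl | rfl | rfl <;>
    rcases hr with rfl | rfl | rfl <;> simp_all

lemma finite_typeIRanges {S : Set Pt} (hS : NiceShape S) {X : Finset Pt} (hX : GenPos S X)
    (k : ℕ) : (typeIRanges S X k).Finite := by
  refine Set.Finite.of_finite_image (f := bdry X) (X.powerset.finite_toSet.subset ?_) ?_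
  · rintro _ ⟨T, -, rfl⟩
    exact Finset.mem_coe.2 (Finset.mem_powerset.2 fun x hx => (mem_bdry.1 hx).1)
  · rintro T ⟨hT, -, hb⟩ T' ⟨hT', -, -⟩ heq
    rw [← coe_bdry, ncard_coe_finset] at hb
    obtain ⟨a, ha, b, hb', c, hc, hs, hbd⟩ := hX.exists_triple hb one_ne_zero
    have key : ∀ x ∈ ({a, b, c} : Finset Pt), x ∈ frontier T ∧ x ∈ frontier T' := fun x hx =>
      ⟨(mem_bdry.1 (hbd ▸ hx : x ∈ bdry X T)).2,
        (mem_bdry.1 ((heq ▸ hbd) ▸ hx : x ∈ bdry X T')).2⟩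
    exact hT.eq_of_frontier hS hT' (p := a) (q := b) (r := c) (by simpa using hs.ne')
      (key a (by simp)).1 (key b (by simp)).1 (key c (by simp)).1
      (key a (by simp)).2 (key b (by simp)).2 (key c (by simp)).2

/-- The ranges with exactly `k` points of `X`, three of them on the boundary, as a finset. -/
def rangesFinset {S : Set Pt} (hS : NiceShape S) {X : Finset Pt} (hX : GenPos S X) (k : ℕ) :
    Finset (Set Pt) := (finite_typeIRanges hS hX k).toFinset

lemma mem_rangesFinset {S : Set Pt} {hS : NiceShape S} {X : Finset Pt} {hX : GenPos S X} {k : ℕ}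
    {T : Set Pt} : T ∈ rangesFinset hS hX k ↔
      IsRange S T ∧ (capt X T).card = k ∧ (bdry X T).card = 3 := by
  rw [rangesFinset, Set.Finite.mem_toFinset, typeIRanges, ← ncard_coe_finset (capt X T),
    ← ncard_coe_finset (bdry X T), coe_capt, coe_bdry]
  rfl

open scoped Classical in
lemma card_triples {S : Set Pt} (hS : NiceShape S) {X : Finset Pt} (hX : GenPos S X) {σ : ℝ}
    (hσ : σ ≠ 0) (k : ℕ) :
    ((X ×ˢ X ×ˢ X).filter fun z => 0 < σ * side z.1 z.2.1 z.2.2 ∧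
      (capt X (circ S z.1 z.2.1 z.2.2)).card = k).card = 3 * (rangesFinset hS hX k).card := by
  rw [Finset.card_eq_sum_card_fiberwise (f := fun z => circ S z.1 z.2.1 z.2.2)
    (t := rangesFinset hS hX k), Finset.sum_const_nat (m := 3), mul_comm]
  · intro T hT
    obtain ⟨hT, hc, hb⟩ := mem_rangesFinset.1 hT
    obtain ⟨a, ha, b, hb', c, hc', hs, hbd⟩ := hX.exists_triple hb hσ
    have hfr : a ∈ frontier T ∧ b ∈ frontier T ∧ c ∈ frontier T :=
      ⟨(mem_bdry.1 (show a ∈ bdry X T by simp [hbd])).2,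
        (mem_bdry.1 (show b ∈ bdry X T by simp [hbd])).2,
        (mem_bdry.1 (show c ∈ bdry X T by simp [hbd])).2⟩
    obtain ⟨hfa, hfb, hfc⟩ := hfr
    obtain ⟨hab, hac, hbc⟩ := ne_of_side_ne_zero (right_ne_zero_of_mul hs.ne')
    have hs₂ : side b c a = side a b c := side_rotate _ _ _
    have hs₃ : side c a b = side a b c := by rw [← side_rotate, ← side_rotate]
    have hs0 := right_ne_zero_of_mul hs.ne'
    rw [Finset.card_eq_three]
    refine ⟨(a, b, c), (b, c, a), (c, a, b), by simp [hab], by simp [hac], by simp [hbc], ?_⟩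
    ext ⟨p, q, r⟩
    simp only [Finset.mem_filter, Finset.mem_product, Finset.mem_insert, Finset.mem_singleton]
    constructor
    · rintro ⟨⟨⟨hp, hq, hr⟩, hs', -⟩, rfl⟩
      have h3 := bdry_circ hS hX hp hq hr (right_ne_zero_of_mul hs'.ne')
      rw [h3] at hbd
      refine eq_cyclic_of_mem hs hs' ?_ ?_ ?_ <;> rw [← hbd] <;> simp
    · have key : ∀ p ∈ X, ∀ q ∈ X, ∀ r ∈ X, side p q r = side a b c → p ∈ frontier T →
          q ∈ frontier T → r ∈ frontier T →
          ((p ∈ X ∧ q ∈ X ∧ r ∈ X) ∧ 0 < σ * side p q r ∧ (capt X (circ S p q r)).card = k) ∧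
            circ S p q r = T := by
        intro p hp q hq r hr hse hpf hqf hrf
        have hci := circ_eq hS hT (hse ▸ hs0 : side p q r ≠ 0) hpf hqf hrf
        exact ⟨⟨⟨hp, hq, hr⟩, hse ▸ hs, hci ▸ hc⟩, hci⟩
      simp only [Prod.mk.injEq]
      rintro (⟨rfl, rfl, rfl⟩ | ⟨rfl, rfl, rfl⟩ | ⟨rfl, rfl, rfl⟩)
      · exact key _ ha _ hb' _ hc' rfl hfa hfb hfc
      · exact key _ hb' _ hc' _ ha hs₂ hfb hfc hfa
      · exact key _ hc' _ ha _ hb' hs₃ hfc hfa hfb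
  · rintro ⟨p, q, r⟩ hz
    simp only [Finset.coe_filter, Finset.mem_product, mem_ofPred_eq] at hz
    obtain ⟨⟨hp, hq, hr⟩, hs, hc⟩ := hz
    have hs0 := right_ne_zero_of_mul hs.ne'
    obtain ⟨hpq, hpr, hqr⟩ := ne_of_side_ne_zero hs0
    refine mem_rangesFinset.2 ⟨(circ_spec hS hs0).1, hc, ?_⟩
    rw [bdry_circ hS hX hp hq hr hs0]
    exact Finset.card_eq_three.2 ⟨p, q, r, hpq, hpr, hqr, rfl⟩

open scoped Classical in
lemma sum_card_third {S : Set Pt} (hS : NiceShape S) {X : Finset Pt} (hX : GenPos S X) {σ : ℝ}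
    (hσ : σ ≠ 0) (k : ℕ) :
    ∑ z ∈ X.offDiag, (X.filter fun r => 0 < σ * side z.1 z.2 r ∧
      (capt X (circ S z.1 z.2 r)).card = k).card = 3 * (rangesFinset hS hX k).card := by
  rw [← card_triples hS hX hσ k, ← Finset.card_sigma]
  refine Finset.card_bij (fun z _ => (z.1.1, z.1.2, z.2)) ?_ ?_ ?_
  · rintro ⟨⟨p, q⟩, r⟩ h
    simp only [Finset.mem_sigma, Finset.mem_offDiag, Finset.mem_filter] at h
    simp only [Finset.mem_filter, Finset.mem_product]
    exact ⟨⟨h.1.1, h.1.2.1, h.2.1⟩, h.2.2⟩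
  · rintro ⟨⟨p, q⟩, r⟩ - ⟨⟨p', q'⟩, r'⟩ - h
    simp only [Prod.mk.injEq] at h
    obtain ⟨rfl, rfl, rfl⟩ := h
    rfl
  · rintro ⟨p, q, r⟩ h
    simp only [Finset.mem_filter, Finset.mem_product] at h
    refine ⟨⟨(p, q), r⟩, ?_, rfl⟩
    simp only [Finset.mem_sigma, Finset.mem_offDiag, Finset.mem_filter]
    exact ⟨⟨h.1.1, h.1.2.1, (ne_of_side_ne_zero (right_ne_zero_of_mul h.2.1.ne')).1⟩, h.1.2.2, h.2⟩

lemma frontier_halfplane {f : Pt →ₗ[ℝ] ℝ} (hf : f ≠ 0) (a : ℝ) :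
    frontier {x | f x ≤ a} = {x | f x = a} := by
  have hc : Continuous f := LinearMap.continuous_of_finiteDimensional f
  have ho : IsOpenMap f := LinearMap.isOpenMap_of_finiteDimensional f (f.surjective hf)
  have h := ho.preimage_frontier_eq_frontier_preimage hc (Iic a)
  rw [frontier_Iic] at h
  exact h.symm

/-- The closed halfplane on the nonnegative side of `p q`. -/
def sideHalfplane (z : Pt × Pt) : Set Pt := {x | 0 ≤ side z.1 z.2 x}

lemma sideHalfplane_eq (p q : Pt) :
    sideHalfplane (p, q) = {x | (-crossWith (q - p)) x ≤ (-crossWith (q - p)) p} := by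
  ext x
  have : side p q x = crossWith (q - p) x - crossWith (q - p) p := by
    simp only [crossWith_apply, side, PiLp.sub_apply]; ring
  simp only [sideHalfplane, mem_ofPred_eq, this, LinearMap.neg_apply, neg_le_neg_iff, sub_nonneg]

lemma frontier_sideHalfplane {p q : Pt} (hpq : p ≠ q) :
    frontier (sideHalfplane (p, q)) = {x | side p q x = 0} := by
  rw [sideHalfplane_eq, frontier_halfplane
    (neg_ne_zero.2 (crossWith_ne_zero (sub_ne_zero.2 hpq.symm)))]
  ext x
  have : side p q x = crossWith (q - p) x - crossWith (q - p) p := by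
    simp only [crossWith_apply, side, PiLp.sub_apply]; ring
  simp only [mem_ofPred_eq, this, LinearMap.neg_apply, neg_inj, sub_eq_zero]

lemma inter_frontier_sideHalfplane {S : Set Pt} {X : Finset Pt} (hX : GenPos S X) {p q : Pt}
    (hp : p ∈ X) (hq : q ∈ X) (hpq : p ≠ q) :
    (X : Set Pt) ∩ frontier (sideHalfplane (p, q)) = {p, q} := by
  rw [frontier_sideHalfplane hpq]
  ext x
  constructor
  · rintro ⟨hx, hs⟩
    by_contra hne
    simp only [mem_insert_iff, mem_singleton_iff, not_or] at hne
    exact hX.side_ne_zero hp hq hx hpq (Ne.symm hne.1) (Ne.symm hne.2) hs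
  · rintro (rfl | rfl)
    · exact ⟨hp, side_left _ _⟩
    · exact ⟨hq, side_right _ _⟩

lemma coe_halfSet (X : Finset Pt) (p q : Pt) :
    (halfSet X p q : Set Pt) = ↑X ∩ sideHalfplane (p, q) := by
  ext x; simp [halfSet, sideHalfplane]

lemma exists_mul_side_of_eq {f : Pt →ₗ[ℝ] ℝ} {p q : Pt} (hpq : p ≠ q) (h : f p = f q) :
    ∃ c : ℝ, ∀ x, f x - f p = c * side p q x := by
  have hf : ∀ x : Pt, f x = x 0 * f !₂[1, 0] + x 1 * f !₂[0, 1] := fun x => by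
    have hx : x = x 0 • !₂[1, 0] + x 1 • !₂[0, 1] := by apply Pt.ext_coord <;> simp
    conv_lhs => rw [hx]
    simp
  set A := f !₂[1, 0]
  set B := f !₂[0, 1]
  set N : ℝ := (q 0 - p 0) ^ 2 + (q 1 - p 1) ^ 2 with hN
  have hNpos : N ≠ 0 := by
    intro h0
    apply hpq
    refine Pt.ext_coord ?_ ?_ <;> nlinarith [sq_nonneg (q 0 - p 0), sq_nonneg (q 1 - p 1)]
  rw [hf, hf q] at h
  have h' : A * (q 0 - p 0) + B * (q 1 - p 1) = 0 := by linarith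
  refine ⟨(B * (q 0 - p 0) - A * (q 1 - p 1)) / N, fun x => ?_⟩
  rw [hf x, hf p, div_mul_eq_mul_div, eq_div_iff hNpos]
  simp only [side, hN]
  linear_combination ((x 0 - p 0) * (q 0 - p 0) + (x 1 - p 1) * (q 1 - p 1)) * h'

lemma sideHalfplane_injOn {S : Set Pt} {X : Finset Pt} (hX : GenPos S X) :
    InjOn sideHalfplane (X.offDiag : Set (Pt × Pt)) := by
  rintro ⟨p, q⟩ hz ⟨p', q'⟩ hz' heq
  obtain ⟨hp, hq, hpq⟩ := Finset.mem_offDiag.1 (Finset.mem_coe.1 hz)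
  obtain ⟨hp', hq', hpq'⟩ := Finset.mem_offDiag.1 (Finset.mem_coe.1 hz')
  simp only at hp hq hpq hp' hq' hpq'
  have h := inter_frontier_sideHalfplane hX hp hq hpq
  rw [heq, inter_frontier_sideHalfplane hX hp' hq' hpq', Set.pair_eq_pair_iff] at h
  rcases h with ⟨rfl, rfl⟩ | ⟨rfl, rfl⟩
  · rfl
  · obtain ⟨x, hx, -⟩ := exists_side_pos_notMem isCompact_empty hpq
    have hmem : x ∈ sideHalfplane (q', p') := hx.le
    rw [heq] at hmem
    have : 0 ≤ side p' q' x := hmem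
    rw [side_swap] at this
    linarith

open scoped Classical in
lemma ncard_repHalfplanes {S : Set Pt} {X : Finset Pt} (hX : GenPos S X) (k : ℕ) :
    (repHalfplanes X k).ncard =
      (X.offDiag.filter fun z => (halfSet X z.1 z.2).card = k).card := by
  have himg : repHalfplanes X k =
      sideHalfplane '' ↑(X.offDiag.filter fun z => (halfSet X z.1 z.2).card = k) := by
    ext H
    constructor
    · rintro ⟨⟨f, a, hf, rfl⟩, hk, h2⟩
      obtain ⟨p, q, hpq, hpair⟩ := Set.ncard_eq_two.1 h2
      rw [frontier_halfplane hf] at hpair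
      have hp : p ∈ X ∧ f p = a := (hpair.symm.subset (mem_insert _ _) : p ∈ _)
      have hq : q ∈ X ∧ f q = a := (hpair.symm.subset (mem_insert_of_mem _ rfl) : q ∈ _)
      obtain ⟨c, hc⟩ := exists_mul_side_of_eq hpq (hp.2.trans hq.2.symm)
      have hc0 : c ≠ 0 := by
        rintro rfl
        apply hf
        ext1 x
        have h1 := hc x
        have h2 := hc 0
        simp only [zero_mul, map_zero] at h1 h2
        simp only [LinearMap.zero_apply]
        linarith
      have key : ∀ z : Pt × Pt, z ∈ X.offDiag → {x | f x ≤ a} = sideHalfplane z →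
          {x | f x ≤ a} ∈
            sideHalfplane '' ↑(X.offDiag.filter fun z => (halfSet X z.1 z.2).card = k) := by
        rintro ⟨u, v⟩ hz heq
        refine ⟨(u, v), Finset.mem_coe.2 (Finset.mem_filter.2 ⟨hz, ?_⟩), heq.symm⟩
        rw [← ncard_coe_finset, coe_halfSet, ← heq]
        exact hk
      rcases hc0.lt_or_gt with hneg | hpos
      · refine key (p, q) (Finset.mem_offDiag.2 ⟨hp.1, hq.1, hpq⟩) ?_
        ext x
        simp only [sideHalfplane, mem_ofPred_eq]
        rw [← sub_nonpos, ← hp.2, hc]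
        exact ⟨fun h => by nlinarith, fun h => by nlinarith⟩
      · refine key (q, p) (Finset.mem_offDiag.2 ⟨hq.1, hp.1, hpq.symm⟩) ?_
        ext x
        simp only [sideHalfplane, mem_ofPred_eq]
        rw [← sub_nonpos, ← hp.2, hc, side_swap]
        exact ⟨fun h => by nlinarith, fun h => by nlinarith⟩
    · rintro ⟨⟨p, q⟩, hz, rfl⟩
      obtain ⟨hz, hk⟩ := Finset.mem_filter.1 (Finset.mem_coe.1 hz)
      obtain ⟨hp, hq, hpq⟩ := Finset.mem_offDiag.1 hz
      refine ⟨⟨_, _, neg_ne_zero.2 (crossWith_ne_zero (sub_ne_zero.2 (Ne.symm hpq))),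
        sideHalfplane_eq p q⟩, ?_, ?_⟩
      · rw [← coe_halfSet, ncard_coe_finset, hk]
      · rw [inter_frontier_sideHalfplane hX hp hq hpq, Set.ncard_pair hpq]
  rw [himg, Set.InjOn.ncard_image, ncard_coe_finset]
  exact (sideHalfplane_injOn hX).mono (Finset.coe_subset.2 (Finset.filter_subset _ _))

open scoped Classical in
lemma sum_card_generic {S : Set Pt} (hS : NiceShape S) {X : Finset Pt} (hX : GenPos S X) (k : ℕ) :
    ∑ z ∈ X.offDiag, ((X.powersetCard k).filter fun Y => Generic S X Y z.1 z.2).card =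
      3 * (rangesFinset hS hX k).card + 3 * (rangesFinset hS hX (k + 1)).card +
        (repHalfplanes X k).ncard := by
  rw [ncard_repHalfplanes hX, Finset.card_filter,
    ← sum_card_third hS hX (neg_ne_zero.2 one_ne_zero) k,
    ← sum_card_third hS hX one_ne_zero (k + 1), ← Finset.sum_add_distrib, ← Finset.sum_add_distrib]
  refine Finset.sum_congr rfl fun z hz => ?_
  obtain ⟨hp, hq, hpq⟩ := Finset.mem_offDiag.1 hz
  rw [card_generic hS hX hp hq hpq]
  simp only [neg_mul, one_mul, Left.neg_pos_iff]

lemma gapSet_generic {S : Set Pt} (hS : NiceShape S) {X : Finset Pt} (hX : GenPos S X)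
    {p q y : Pt} (hp : p ∈ X) (hq : q ∈ X) (hy : y ∈ X) (hs : side p q y < 0) :
    Generic S X (capt X (circ S p q y)) p q :=
  (generic_iff hS hX hp hq (ne_of_side_ne_zero hs.ne).1).2
    (Or.inr ⟨y, hy, hs.ne, (gapSet_of_neg hs).symm⟩)

lemma exists_generic {S : Set Pt} (hS : NiceShape S) {X : Finset Pt} (hX : GenPos S X) {T : Set Pt}
    (hT : IsRange S T) (hcard : 2 ≤ (capt X T).card) :
    ∃ p ∈ X, ∃ q ∈ X, p ≠ q ∧ Generic S X (capt X T) p q := by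
  obtain ⟨T', hT', hsub, hYT', p, hpY, q, hqY, hpq, hpf, hqf⟩ := hT.exists_shrink_two hS
    (Y := capt X T) (fun x hx => (mem_capt.1 hx).2) hcard
  have hcapt : capt X T' = capt X T := by
    ext x
    exact ⟨fun hx => mem_capt.2 ⟨(mem_capt.1 hx).1, hsub (mem_capt.1 hx).2⟩,
      fun hx => mem_capt.2 ⟨(mem_capt.1 hx).1, hYT' hx⟩⟩
  have hp := (mem_capt.1 hpY).1
  have hq := (mem_capt.1 hqY).1
  refine ⟨p, hp, q, hq, hpq, ?_⟩
  rw [← hcapt]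
  by_cases hex : ∃ w ∈ bdry X T', w ≠ p ∧ w ≠ q
  · obtain ⟨w, hw, hwp, hwq⟩ := hex
    obtain ⟨hwX, hwf⟩ := mem_bdry.1 hw
    have hs := hX.side_ne_zero hp hq hwX hpq hwp.symm hwq.symm
    rcases hs.lt_or_gt with h | h
    · have := gapSet_generic hS hX hp hq hwX h
      rwa [circ_eq hS hT' hs hpf hqf hwf] at this
    · have hs' : side q p w < 0 := by rw [side_swap]; linarith
      have := gapSet_generic hS hX hq hp hwX hs'
      rw [circ_eq hS hT' hs'.ne hqf hpf hwf] at this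
      exact this.swap
  · push Not at hex
    refine ⟨T', hT', rfl, ?_⟩
    ext x
    rw [Finset.mem_insert, Finset.mem_singleton]
    refine ⟨fun hx => or_iff_not_imp_left.2 (hex x hx), ?_⟩
    rintro (rfl | rfl)
    · exact mem_bdry.2 ⟨hp, hpf⟩
    · exact mem_bdry.2 ⟨hq, hqf⟩

/-- A reference range capturing `Y` with exactly two points of `X` on its boundary. -/
structure IsReference (S : Set Pt) (X Y : Finset Pt) (T₀ : Set Pt) : Prop where
  isRange : IsRange S T₀
  capt_eq : capt X T₀ = Y
  card_bdry : (bdry X T₀).card = 2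

/-- The range through `p`, `q`, `y` captures `Y`, and its cap across `p q` from `y` lies
in `T₀`. -/
structure Good (S : Set Pt) (X Y : Finset Pt) (T₀ : Set Pt) (p q y : Pt) : Prop where
  left_mem : p ∈ X
  right_mem : q ∈ X
  mem : y ∈ X
  side_neg : side p q y < 0
  capt_eq : capt X (circ S p q y) = Y
  cap_subset : ∀ u ∈ circ S p q y, 0 < side p q u → u ∈ T₀

lemma IsRange.subset_of_caps {S T T₀ : Set Pt} (hS : NiceShape S) (hT : IsRange S T)
    (hT₀ : IsRange S T₀) {p q : Pt} (hpq : p ≠ q) (hp : p ∈ frontier T) (hq : q ∈ frontier T)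
    (hp₀ : p ∈ T₀) (hq₀ : q ∈ T₀) (hpos : ∀ u ∈ T, 0 < side p q u → u ∈ T₀)
    (hneg : ∀ u ∈ T, side p q u < 0 → u ∈ T₀) : T ⊆ T₀ := by
  intro u hu
  rcases lt_trichotomy (side p q u) 0 with hs | hs | hs
  · exact hneg u hu hs
  · rw [hT.mem_frontier_iff hS] at hp hq
    obtain ⟨r, hr0, hr1, rfl⟩ := mem_segment_of_side_eq_zero (hT.strictConvex hS) hpq
      hp.1 hq.1 hp.2 hq.2 hu hs
    exact (hT₀.strictConvex hS).convex.add_smul_sub_mem hp₀ hq₀ ⟨hr0, hr1⟩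
  · exact hpos u hu hs

namespace IsReference

variable {S : Set Pt} {X Y : Finset Pt} {T₀ T : Set Pt} {p q y : Pt}

lemma mem_of_mem (h : IsReference S X Y T₀) (hy : y ∈ Y) : y ∈ T₀ := by
  rw [← h.capt_eq] at hy
  exact (mem_capt.1 hy).2

lemma eq_of_subset (h : IsReference S X Y T₀) (hS : NiceShape S) (hT : IsRange S T)
    (hsub : T ⊆ T₀) (hY : (Y : Set Pt) ⊆ T) : T = T₀ := by
  obtain ⟨p, q, hpq, hb⟩ := Finset.card_eq_two.1 h.card_bdry
  have key : ∀ x ∈ bdry X T₀, x ∈ T ∧ x ∈ frontier T₀ := by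
    intro x hx
    obtain ⟨hxX, hxf⟩ := mem_bdry.1 hx
    refine ⟨hY ?_, hxf⟩
    rw [← h.capt_eq]
    exact Finset.mem_coe.2 (mem_capt.2 ⟨hxX, h.isRange.mem_of_mem_frontier hS hxf⟩)
  have hp := key p (by simp [hb])
  have hq := key q (by simp [hb])
  exact hT.eq_of_subset hS h.isRange hsub hpq hp.1 hq.1 hp.2 hq.2

lemma circ_ne (h : IsReference S X Y T₀) (hS : NiceShape S) (hX : GenPos S X) (hp : p ∈ X)
    (hq : q ∈ X) (hy : y ∈ X) (hs : side p q y ≠ 0) : circ S p q y ≠ T₀ := by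
  intro heq
  have h2 := h.card_bdry
  obtain ⟨hpq, hpy, hqy⟩ := ne_of_side_ne_zero hs
  rw [← heq, bdry_circ hS hX hp hq hy hs,
    Finset.card_eq_three.2 ⟨p, q, y, hpq, hpy, hqy, rfl⟩] at h2
  omega

lemma exists_good (h : IsReference S X Y T₀) (hS : NiceShape S) (hX : GenPos S X) {T' : Set Pt}
    (hp : p ∈ X) (hq : q ∈ X) (hpq : p ≠ q) (hT : IsRange S T) (hpT : p ∈ frontier T)
    (hqT : q ∈ frontier T) (hTY : capt X T = Y) (hT' : IsRange S T') (hpT' : p ∈ frontier T')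
    (hqT' : q ∈ frontier T') (hsub : T' ⊆ T₀) (hcap : ∀ u ∈ T, 0 < side p q u → u ∈ T')
    (hY : ¬ (Y : Set Pt) ⊆ T') : ∃ y, Good S X Y T₀ p q y := by
  classical
  obtain ⟨P, thr, hP⟩ := exists_isPencil hS hpq
  obtain ⟨t, rfl⟩ := hP.exists_eq T hT hpT hqT
  obtain ⟨s, rfl⟩ := hP.exists_eq T' hT' hpT' hqT'
  have hXY : ∀ x, x ∈ Y ↔ x ∈ X ∧ x ∈ P t := fun x => by rw [← hTY, mem_capt]
  obtain ⟨w, hwY, hws⟩ := Set.not_subset.1 hY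
  obtain ⟨hwX, hwt⟩ := (hXY w).1 hwY
  have hwneg : side p q w < 0 := by
    rcases IsPencil.side_pos_or_neg hX hp hq hpq hwX with rfl | rfl | hs | hs
    · exact absurd (hP.left_mem hS s) hws
    · exact absurd (hP.right_mem hS s) hws
    · exact absurd (hcap w hwt hs) hws
    · exact hs
  have hwlt : thr w < s := by rwa [hP.mem_iff_of_neg hS hwneg, not_le] at hws
  obtain ⟨y, hyF, hmin⟩ := (Y.filter (side p q · < 0)).exists_min_image thr
    ⟨w, Finset.mem_filter.2 ⟨hwY, hwneg⟩⟩
  obtain ⟨hyY, hys⟩ := Finset.mem_filter.1 hyF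
  obtain ⟨hyX, hyt⟩ := (hXY y).1 hyY
  have hys' : thr y < s := (hmin w (Finset.mem_filter.2 ⟨hwY, hwneg⟩)).trans_lt hwlt
  have hty : t ≤ thr y := (hP.mem_iff_of_neg hS hys).1 hyt
  have hcap' : ∀ u ∈ P (thr y), 0 < side p q u → u ∈ T₀ := fun u hu hus =>
    hsub (interior_subset (hP.pos_lt hys' hu hus))
  refine ⟨y, hp, hq, hyX, hys, ?_, ?_⟩
  · rw [hP.circ_eq hS hys.ne]
    ext x
    rw [mem_capt, hXY]
    refine and_congr_right fun hx => ?_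
    rcases IsPencil.side_pos_or_neg hX hp hq hpq hx with rfl | rfl | hs | hs
    · exact iff_of_true (hP.left_mem hS _) (hP.left_mem hS _)
    · exact iff_of_true (hP.right_mem hS _) (hP.right_mem hS _)
    · constructor
      · intro hxy
        have : x ∈ capt X T₀ := mem_capt.2 ⟨hx, hcap' x hxy hs⟩
        rw [h.capt_eq, hXY] at this
        exact this.2
      · rw [hP.mem_iff_of_pos hS hs, hP.mem_iff_of_pos hS hs]
        exact fun h1 => h1.trans hty
    · constructor
      · rw [hP.mem_iff_of_neg hS hs, hP.mem_iff_of_neg hS hs]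
        exact fun h1 => hty.trans h1
      · intro hxt
        rw [hP.mem_iff_of_neg hS hs]
        exact hmin x (Finset.mem_filter.2 ⟨(hXY x).2 ⟨hx, hxt⟩, hs⟩)
  · rw [hP.circ_eq hS hys.ne]
    exact hcap'

lemma exists_good_of_generic (h : IsReference S X Y T₀) (hS : NiceShape S) (hX : GenPos S X)
    (hp : p ∈ X) (hq : q ∈ X) (hpq : p ≠ q) (hg : Generic S X Y p q)
    (hn : ¬ (p ∈ bdry X T₀ ∧ q ∈ bdry X T₀)) :
    (∃ y, Good S X Y T₀ p q y) ∨ ∃ y, Good S X Y T₀ q p y := by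
  obtain ⟨T, hT, hTY, hb⟩ := hg
  have hpT : p ∈ frontier T := (mem_bdry.1 (show p ∈ bdry X T by simp [hb])).2
  have hqT : q ∈ frontier T := (mem_bdry.1 (show q ∈ bdry X T by simp [hb])).2
  have hp₀ : p ∈ T₀ := h.mem_of_mem (hTY ▸ mem_capt.2 ⟨hp, hT.mem_of_mem_frontier hS hpT⟩)
  have hq₀ : q ∈ T₀ := h.mem_of_mem (hTY ▸ mem_capt.2 ⟨hq, hT.mem_of_mem_frontier hS hqT⟩)
  obtain ⟨P, thr, hP⟩ := exists_isPencil hS hpq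
  obtain ⟨s, hs⟩ := hP.exists_subset hS hpq h.isRange hp₀ hq₀
  have hY : ¬ (Y : Set Pt) ⊆ P s := fun hY => by
    have heq := h.eq_of_subset hS (hP.isRange s) hs hY
    exact hn ⟨mem_bdry.2 ⟨hp, heq ▸ hP.left s⟩, mem_bdry.2 ⟨hq, heq ▸ hP.right s⟩⟩
  have hne : T ≠ P s := fun heq => hY fun y hy => by
    rw [← hTY] at hy
    exact heq ▸ (mem_capt.1 hy).2
  rcases hT.cap_dichotomy hS (hP.isRange s) hne hpq hpT hqT (hP.left s) (hP.right s) with hc | hc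
  · exact Or.inl (h.exists_good hS hX hp hq hpq hT hpT hqT hTY (hP.isRange s) (hP.left s)
      (hP.right s) hs (fun u hu hus => interior_subset (hc.1 u hu hus)) hY)
  · refine Or.inr (h.exists_good hS hX hq hp hpq.symm hT hqT hpT hTY (hP.isRange s) (hP.right s)
      (hP.left s) hs (fun u hu hus => interior_subset (hc.1 u hu ?_)) hY)
    rw [side_swap] at hus
    linarith

lemma not_good_both (h : IsReference S X Y T₀) (hS : NiceShape S) (hX : GenPos S X) {y' : Pt}
    (hg : Good S X Y T₀ p q y) (hg' : Good S X Y T₀ q p y') : False := by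
  have hpq := (ne_of_side_ne_zero hg.side_neg.ne).1
  obtain ⟨P, thr, hP⟩ := exists_isPencil hS hpq
  have hpos : 0 < side p q y' := by rw [side_swap]; linarith [hg'.side_neg]
  obtain ⟨h1, h2, h3, h4⟩ := circ_spec hS hg'.side_neg.ne
  have heq : circ S q p y' = P (thr y') := by
    rw [← hP.circ_eq hS hpos.ne', circ_eq hS h1 hpos.ne' h3 h2 h4]
  have heq₁ : circ S p q y = P (thr y) := hP.circ_eq hS hg.side_neg.ne
  have hyY : y ∈ Y := by
    rw [← hg.capt_eq, heq₁]
    exact mem_capt.2 ⟨hg.mem, hP.thr_mem' hS hg.side_neg.ne⟩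
  have hyT : thr y' ≤ thr y := by
    rw [← hP.mem_iff_of_neg hS hg.side_neg, ← heq]
    rw [← hg'.capt_eq] at hyY
    exact (mem_capt.1 hyY).2
  have hYT : (Y : Set Pt) ⊆ circ S q p y' := fun x hx => by
    rw [← hg'.capt_eq] at hx
    exact (mem_capt.1 hx).2
  have hpY : p ∈ Y := by
    rw [← hg'.capt_eq]; exact mem_capt.2 ⟨hg.left_mem, h1.mem_of_mem_frontier hS h3⟩
  have hqY : q ∈ Y := by
    rw [← hg'.capt_eq]; exact mem_capt.2 ⟨hg.right_mem, h1.mem_of_mem_frontier hS h2⟩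
  have hsub : circ S q p y' ⊆ T₀ := by
    refine h1.subset_of_caps hS h.isRange hpq h3 h2 (h.mem_of_mem hpY) (h.mem_of_mem hqY) ?_ ?_
    · intro u hu hus
      refine hg.cap_subset u ?_ hus
      rw [heq, hP.mem_iff_of_pos hS hus] at hu
      rw [heq₁, hP.mem_iff_of_pos hS hus]
      exact hu.trans hyT
    · intro u hu hus
      exact hg'.cap_subset u hu (by rw [side_swap]; linarith)
  exact h.circ_ne hS hX hg.right_mem hg.left_mem hg'.mem hg'.side_neg.ne
    (h.eq_of_subset hS h1 hsub hYT)

lemma not_good_of_mem_bdry (h : IsReference S X Y T₀) (hS : NiceShape S) (hX : GenPos S X)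
    (hg : Good S X Y T₀ p q y) (hp : p ∈ bdry X T₀) (hq : q ∈ bdry X T₀) : False := by
  have hpq := (ne_of_side_ne_zero hg.side_neg.ne).1
  obtain ⟨h1, h2, h3, h4⟩ := circ_spec hS hg.side_neg.ne
  obtain ⟨-, hpf⟩ := mem_bdry.1 hp
  obtain ⟨-, hqf⟩ := mem_bdry.1 hq
  have hne := h.circ_ne hS hX hg.left_mem hg.right_mem hg.mem hg.side_neg.ne
  have hyY : y ∈ Y := by
    rw [← hg.capt_eq]; exact mem_capt.2 ⟨hg.mem, h1.mem_of_mem_frontier hS h4⟩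
  rcases h1.cap_dichotomy hS h.isRange hne hpq h2 h3 hpf hqf with hc | hc
  · exact h4.2 (hc.2 y (h.mem_of_mem hyY) hg.side_neg)
  · refine hne (h.eq_of_subset hS h1 (h1.subset_of_caps hS h.isRange hpq h2 h3
      (h.isRange.mem_of_mem_frontier hS hpf) (h.isRange.mem_of_mem_frontier hS hqf) hg.cap_subset
      fun u hu hus => interior_subset (hc.1 u hu hus)) fun x hx => ?_)
    rw [← hg.capt_eq] at hx
    exact (mem_capt.1 hx).2

end IsReference

lemma Good.third_unique {S : Set Pt} (hS : NiceShape S) {X Y : Finset Pt} (hX : GenPos S X)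
    {T₀ : Set Pt} {p q y y' : Pt} (hg : Good S X Y T₀ p q y) (hg' : Good S X Y T₀ p q y') :
    y = y' := by
  have hpq := (ne_of_side_ne_zero hg.side_neg.ne).1
  obtain ⟨P, thr, hP⟩ := exists_isPencil hS hpq
  refine hP.gapSet_injective hS hX hg.left_mem hg.right_mem hpq hg.mem hg.side_neg.ne hg'.mem
    hg'.side_neg.ne ?_
  rw [gapSet_of_neg hg.side_neg, gapSet_of_neg hg'.side_neg, hg.capt_eq, hg'.capt_eq]

lemma combo_of_sides {a b c : Pt} (hs : side a b c ≠ 0) (u : Pt) :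
    u = (side b c u / side a b c) • a + (side c a u / side a b c) • b +
      (side a b u / side a b c) • c := by
  apply Pt.ext_coord <;> simp only [PiLp.add_apply, PiLp.smul_apply, smul_eq_mul] <;>
    field_simp <;> simp only [side] <;> ring

lemma Convex.mem_of_sides {T : Set Pt} (hT : Convex ℝ T) {a b c u : Pt} (ha : a ∈ T) (hb : b ∈ T)
    (hc : c ∈ T) (hs : side a b c < 0) (h₁ : side a b u ≤ 0) (h₂ : side b c u ≤ 0)
    (h₃ : side c a u ≤ 0) : u ∈ T := by
  rw [combo_of_sides hs.ne u]
  have hsum : side a b u + side b c u + side c a u = side a b c := by simp only [side]; ring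
  have hone : side b c u / side a b c + side c a u / side a b c + side a b u / side a b c = 1 := by
    rw [← add_div, ← add_div, div_eq_one_iff_eq hs.ne]
    linarith
  have := hT.sum_mem (t := Finset.univ)
    (w := ![side b c u / side a b c, side c a u / side a b c, side a b u / side a b c])
    (z := ![a, b, c])
    (by simp [Fin.forall_fin_succ, div_nonneg_of_nonpos, h₁, h₂, h₃, hs.le])
    (by simpa [Fin.sum_univ_three] using hone) (by simp [Fin.forall_fin_succ, ha, hb, hc])
  simpa [Fin.sum_univ_three] using this

lemma StrictConvex.side_eq_zero_of_nonneg {T : Set Pt} (hT : StrictConvex ℝ T) {a b c u : Pt}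
    (ha : a ∈ T) (hb : b ∉ interior T) (hc : c ∈ T) (hu : u ∈ T) (hs : side a b c < 0)
    (h : 0 ≤ side a b u) (h' : 0 ≤ side b c u) : side a b u = 0 ∧ side b c u = 0 := by
  by_contra hne
  have hpos : 0 < side b c u + side a b u := by
    by_contra! hle
    exact hne ⟨by linarith, by linarith⟩
  have hd : 0 < side a b u + side b c u - side a b c := by linarith
  have hbu : b = (-side a b c / (side a b u + side b c u - side a b c)) • u +
      (side b c u / (side a b u + side b c u - side a b c)) • a +
      (side a b u / (side a b u + side b c u - side a b c)) • c := by
    apply Pt.ext_coord <;> simp only [PiLp.add_apply, PiLp.smul_apply, smul_eq_mul] <;>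
      field_simp <;> simp only [side] <;> ring
  have hw : 0 < side b c u / (side a b u + side b c u - side a b c) +
      side a b u / (side a b u + side b c u - side a b c) := by
    rw [← add_div]
    positivity
  have hone : -side a b c / (side a b u + side b c u - side a b c) +
      side b c u / (side a b u + side b c u - side a b c) +
      side a b u / (side a b u + side b c u - side a b c) = 1 := by
    rw [← add_div, ← add_div, div_eq_one_iff_eq hd.ne']
    ring
  have hu0 := div_pos (neg_pos.2 hs) hd
  apply hb
  rw [hbu]
  rcases h'.lt_or_eq with h₁ | h₁
  · exact hT.combo_mem_interior hu ha hc h₁ ((side_rotate a b c).trans_lt hs).le (by simp)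
      hu0 (by positivity) (by positivity) hw hone
  · exact hT.combo_mem_interior hu ha hc (p := a) (q := b) (by linarith) (by simp) hs.le
      hu0 (by positivity) (by positivity) hw hone

namespace IsReference

variable {S : Set Pt} {X Y : Finset Pt} {T₀ T : Set Pt} {a b c : Pt}

lemma caps_of_not_cap (h : IsReference S X Y T₀) (hS : NiceShape S) (hT : IsRange S T)
    (hne : T ≠ T₀) (hs : side a b c < 0) (ha : a ∈ frontier T) (hb : b ∈ frontier T)
    (hc : c ∈ frontier T) (ha₀ : a ∈ T₀) (hb₀ : b ∈ T₀)
    (hn : ¬ ∀ u ∈ T, 0 < side a b u → u ∈ T₀) :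
    (∀ u ∈ T, 0 < side b c u → u ∈ T₀) ∧ ∀ u ∈ T, 0 < side c a u → u ∈ T₀ := by
  have hsc := hT.strictConvex hS
  have haT := hT.mem_of_mem_frontier hS ha
  have hbT := hT.mem_of_mem_frontier hS hb
  have hcT := hT.mem_of_mem_frontier hS hc
  rcases hT.cap_subset_interior hS h.isRange hne (ne_of_side_ne_zero hs.ne).1 ha hb ha₀ hb₀
    with hcap | hcap
  · exact absurd (fun u hu hus => interior_subset (hcap u hu hus)) hn
  · refine ⟨fun u hu hus => interior_subset (hcap u hu (not_le.1 fun hu' => hus.ne' ?_)),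
      fun u hu hus => interior_subset (hcap u hu (not_le.1 fun hu' => hus.ne' ?_))⟩
    · exact (hsc.side_eq_zero_of_nonneg haT hb.2 hcT hu hs hu' hus.le).2
    · exact (hsc.side_eq_zero_of_nonneg hcT ha.2 hbT hu ((side_rotate c a b).symm.trans_lt hs)
        hus.le hu').1

lemma exists_not_cap (h : IsReference S X Y T₀) (hS : NiceShape S) (hT : IsRange S T)
    (hne : T ≠ T₀) (hY : (Y : Set Pt) ⊆ T) (hs : side a b c < 0) (ha : a ∈ T₀) (hb : b ∈ T₀)
    (hc : c ∈ T₀) :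
    (¬ ∀ u ∈ T, 0 < side a b u → u ∈ T₀) ∨ (¬ ∀ u ∈ T, 0 < side b c u → u ∈ T₀) ∨
      ¬ ∀ u ∈ T, 0 < side c a u → u ∈ T₀ := by
  by_contra! hall
  refine hne (h.eq_of_subset hS hT (fun u hu => ?_) hY)
  by_contra hu₀
  exact hu₀ ((h.isRange.strictConvex hS).convex.mem_of_sides ha hb hc hs
    (not_lt.1 fun h' => hu₀ (hall.1 u hu h')) (not_lt.1 fun h' => hu₀ (hall.2.1 u hu h'))
    (not_lt.1 fun h' => hu₀ (hall.2.2 u hu h')))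

end IsReference

namespace IsReference

variable {S : Set Pt} {X Y : Finset Pt} {T₀ T : Set Pt}

lemma exists_not_cap_triple (h : IsReference S X Y T₀) (hS : NiceShape S) (hX : GenPos S X)
    (hT : IsRange S T) (hTY : capt X T = Y) (hbd : (bdry X T).card = 3) :
    ∃ a b c, side a b c < 0 ∧ bdry X T = {a, b, c} ∧ ¬ ∀ u ∈ T, 0 < side a b u → u ∈ T₀ := by
  have hne : T ≠ T₀ := by
    rintro rfl
    have := h.card_bdry
    omega
  obtain ⟨a, ha, b, hb, c, hc, hs, habc⟩ := hX.exists_triple hbd (σ := -1) (by norm_num)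
  have hs : side a b c < 0 := by linarith
  have key : ∀ x ∈ bdry X T, x ∈ T₀ := fun x hx => by
    obtain ⟨hxX, hxT⟩ := mem_bdry.1 hx
    exact h.mem_of_mem (hTY ▸ mem_capt.2 ⟨hxX, hT.mem_of_mem_frontier hS hxT⟩)
  have hY : (Y : Set Pt) ⊆ T := fun x hx => (mem_capt.1 (hTY ▸ hx : x ∈ capt X T)).2
  rcases h.exists_not_cap hS hT hne hY hs (key a (by simp [habc])) (key b (by simp [habc]))
    (key c (by simp [habc])) with hn | hn | hn
  · exact ⟨a, b, c, hs, habc, hn⟩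
  · refine ⟨b, c, a, (side_rotate a b c).trans_lt hs, ?_, hn⟩
    rw [habc]; ext x; simp; tauto
  · refine ⟨c, a, b, (side_rotate c a b).symm.trans_lt hs, ?_, hn⟩
    rw [habc]; ext x; simp; tauto

open scoped Classical in
lemma card_good (h : IsReference S X Y T₀) (hS : NiceShape S) (hX : GenPos S X) :
    ((X ×ˢ X ×ˢ X).filter fun z => Good S X Y T₀ z.1 z.2.1 z.2.2).card =
      2 * ((rangesFinset hS hX Y.card).filter fun T => capt X T = Y).card := by
  rw [Finset.card_eq_sum_card_fiberwise (f := fun z => circ S z.1 z.2.1 z.2.2)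
    (t := (rangesFinset hS hX Y.card).filter fun T => capt X T = Y),
    Finset.sum_const_nat (m := 2), mul_comm]
  · intro T hT
    obtain ⟨hT, hTY⟩ := Finset.mem_filter.1 hT
    obtain ⟨hT, -, hbd⟩ := mem_rangesFinset.1 hT
    have hne : T ≠ T₀ := by
      rintro rfl
      have := h.card_bdry
      omega
    obtain ⟨a, b, c, hs, habc, hn⟩ := h.exists_not_cap_triple hS hX hT hTY hbd
    have key : ∀ x ∈ ({a, b, c} : Finset Pt), x ∈ X ∧ x ∈ frontier T ∧ x ∈ T₀ := by
      intro x hx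
      obtain ⟨hxX, hxT⟩ := mem_bdry.1 (habc ▸ hx : x ∈ bdry X T)
      exact ⟨hxX, hxT, h.mem_of_mem (hTY ▸ mem_capt.2 ⟨hxX, hT.mem_of_mem_frontier hS hxT⟩)⟩
    obtain ⟨haX, haT, ha₀⟩ := key a (by simp)
    obtain ⟨hbX, hbT, hb₀⟩ := key b (by simp)
    obtain ⟨hcX, hcT, hc₀⟩ := key c (by simp)
    obtain ⟨hbc, hca⟩ := h.caps_of_not_cap hS hT hne hs haT hbT hcT ha₀ hb₀ hn
    have hs₂ : side b c a < 0 := (side_rotate a b c).trans_lt hs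
    have hs₃ : side c a b < 0 := (side_rotate c a b).symm.trans_lt hs
    rw [Finset.card_eq_two]
    refine ⟨(b, c, a), (c, a, b), by simp [(ne_of_side_ne_zero hs.ne).2.2], ?_⟩
    ext ⟨p, q, r⟩
    simp only [Finset.mem_filter, Finset.mem_product, Finset.mem_insert, Finset.mem_singleton]
    constructor
    · rintro ⟨⟨-, hg⟩, rfl⟩
      have h3 := bdry_circ hS hX hg.left_mem hg.right_mem hg.mem hg.side_neg.ne
      rw [h3] at habc
      have hcyc := eq_cyclic_of_mem (a := a) (b := b) (c := c) (p := p) (q := q) (r := r)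
        (σ := -1) (by linarith) (by linarith [hg.side_neg]) (by rw [← habc]; simp)
        (by rw [← habc]; simp) (by rw [← habc]; simp)
      refine hcyc.resolve_left fun heq => hn ?_
      simp only [Prod.mk.injEq] at heq
      obtain ⟨rfl, rfl, rfl⟩ := heq
      exact hg.cap_subset
    · simp only [Prod.mk.injEq]
      rintro (⟨rfl, rfl, rfl⟩ | ⟨rfl, rfl, rfl⟩)
      · have hci := circ_eq hS hT hs₂.ne hbT hcT haT
        exact ⟨⟨⟨hbX, hcX, haX⟩, hbX, hcX, haX, hs₂, hci ▸ hTY, hci ▸ hbc⟩, hci⟩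
      · have hci := circ_eq hS hT hs₃.ne hcT haT hbT
        exact ⟨⟨⟨hcX, haX, hbX⟩, hcX, haX, hbX, hs₃, hci ▸ hTY, hci ▸ hca⟩, hci⟩
  · rintro ⟨p, q, r⟩ hz
    simp only [Finset.coe_filter, Finset.mem_product, mem_ofPred_eq] at hz
    obtain ⟨-, hg⟩ := hz
    obtain ⟨hpq, hpr, hqr⟩ := ne_of_side_ne_zero hg.side_neg.ne
    refine Finset.mem_coe.2 (Finset.mem_filter.2 ⟨mem_rangesFinset.2
      ⟨(circ_spec hS hg.side_neg.ne).1, congrArg Finset.card hg.capt_eq, ?_⟩, hg.capt_eq⟩)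
    rw [bdry_circ hS hX hg.left_mem hg.right_mem hg.mem hg.side_neg.ne]
    exact Finset.card_eq_three.2 ⟨p, q, r, hpq, hpr, hqr, rfl⟩

open scoped Classical in
lemma card_generic_pairs (h : IsReference S X Y T₀) (hS : NiceShape S) (hX : GenPos S X) :
    (X.offDiag.filter fun z => Generic S X Y z.1 z.2).card =
      4 * ((rangesFinset hS hX Y.card).filter fun T => capt X T = Y).card + 2 := by
  set W := (X ×ˢ X ×ˢ X).filter fun z => Good S X Y T₀ z.1 z.2.1 z.2.2 with hW
  have hWg : ∀ {p q y}, (p, q, y) ∈ W ↔ Good S X Y T₀ p q y := by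
    intro p q y
    simp only [hW, Finset.mem_filter, Finset.mem_product]
    exact ⟨fun hg => hg.2, fun hg => ⟨⟨hg.left_mem, hg.right_mem, hg.mem⟩, hg⟩⟩
  set G := W.image fun z => (z.1, z.2.1) with hG
  have hGg : ∀ {p q}, (p, q) ∈ G ↔ ∃ y, Good S X Y T₀ p q y := by
    intro p q
    rw [hG, Finset.mem_image]
    constructor
    · rintro ⟨⟨p', q', y⟩, hz, heq⟩
      simp only [Prod.mk.injEq] at heq
      obtain ⟨rfl, rfl⟩ := heq
      exact ⟨y, hWg.1 hz⟩
    · rintro ⟨y, hy⟩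
      exact ⟨(p, q, y), hWg.2 hy, rfl⟩
  have hGc : G.card = W.card := by
    refine Finset.card_image_of_injOn ?_
    rintro ⟨p, q, y⟩ hz ⟨p', q', y'⟩ hz' heq
    simp only [Prod.mk.injEq] at heq
    obtain ⟨rfl, rfl⟩ := heq
    rw [(hWg.1 hz).third_unique hS hX (hWg.1 hz')]
  set G' := G.image Prod.swap with hG'
  have hGg' : ∀ {p q}, (p, q) ∈ G' ↔ ∃ y, Good S X Y T₀ q p y := by
    intro p q
    rw [← hGg, hG', Finset.mem_image]
    constructor
    · rintro ⟨⟨p', q'⟩, hz, heq⟩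
      simp only [Prod.swap_prod_mk, Prod.mk.injEq] at heq
      obtain ⟨rfl, rfl⟩ := heq
      exact hz
    · exact fun hz => ⟨(q, p), hz, rfl⟩
  have hGc' : G'.card = W.card := by
    rw [hG', Finset.card_image_of_injective _ Prod.swap_injective, hGc]
  have hbX : bdry X T₀ ⊆ X := fun x hx => (mem_bdry.1 hx).1
  have hset : (X.offDiag.filter fun z => Generic S X Y z.1 z.2) =
      (bdry X T₀).offDiag ∪ (G ∪ G') := by
    ext ⟨p, q⟩
    simp only [Finset.mem_union, Finset.mem_filter, Finset.mem_offDiag, hGg, hGg']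
    constructor
    · rintro ⟨⟨hp, hq, hpq⟩, hg⟩
      by_cases hb : p ∈ bdry X T₀ ∧ q ∈ bdry X T₀
      · exact Or.inl ⟨hb.1, hb.2, hpq⟩
      · exact Or.inr (h.exists_good_of_generic hS hX hp hq hpq hg hb)
    · rintro (⟨hp, hq, hpq⟩ | ⟨y, hg⟩ | ⟨y, hg⟩)
      · refine ⟨⟨hbX hp, hbX hq, hpq⟩, T₀, h.isRange, h.capt_eq, Eq.symm ?_⟩
        refine Finset.eq_of_subset_of_card_le ?_ ?_
        · rw [Finset.insert_subset_iff, Finset.singleton_subset_iff]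
          exact ⟨hp, hq⟩
        · rw [h.card_bdry, Finset.card_pair hpq]
      · refine ⟨⟨hg.left_mem, hg.right_mem, (ne_of_side_ne_zero hg.side_neg.ne).1⟩, ?_⟩
        have := gapSet_generic hS hX hg.left_mem hg.right_mem hg.mem hg.side_neg
        rwa [hg.capt_eq] at this
      · refine ⟨⟨hg.right_mem, hg.left_mem, (ne_of_side_ne_zero hg.side_neg.ne).1.symm⟩, ?_⟩
        have := gapSet_generic hS hX hg.left_mem hg.right_mem hg.mem hg.side_neg
        rw [hg.capt_eq] at this
        exact this.swap
  have hd : Disjoint G G' := by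
    rw [Finset.disjoint_left]
    rintro ⟨p, q⟩ h1 h2
    obtain ⟨y, hy⟩ := hGg.1 h1
    obtain ⟨y', hy'⟩ := hGg'.1 h2
    exact h.not_good_both hS hX hy hy'
  have hd' : Disjoint (bdry X T₀).offDiag (G ∪ G') := by
    rw [Finset.disjoint_left]
    rintro ⟨p, q⟩ h1 h2
    rw [Finset.mem_offDiag] at h1
    rcases Finset.mem_union.1 h2 with h2 | h2
    · obtain ⟨y, hy⟩ := hGg.1 h2
      exact h.not_good_of_mem_bdry hS hX hy h1.1 h1.2.1
    · obtain ⟨y, hy⟩ := hGg'.1 h2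
      exact h.not_good_of_mem_bdry hS hX hy h1.2.1 h1.1
  rw [hset, Finset.card_union_of_disjoint hd', Finset.card_union_of_disjoint hd,
    Finset.offDiag_card, h.card_bdry, hGc, hGc', hW, h.card_good hS hX]
  omega

end IsReference

open scoped Classical in
/-- The `k`-element subsets of `X` captured by some range, as a finset of finsets. -/
def capturedFinset (S : Set Pt) (X : Finset Pt) (k : ℕ) : Finset (Finset Pt) :=
  (X.powersetCard k).filter fun Y => ∃ T, IsRange S T ∧ capt X T = Y

lemma capt_subset {X : Finset Pt} {T : Set Pt} : capt X T ⊆ X := fun _ hx => (mem_capt.1 hx).1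

lemma mem_capturedFinset {S : Set Pt} {X : Finset Pt} {k : ℕ} {Y : Finset Pt} :
    Y ∈ capturedFinset S X k ↔ Y.card = k ∧ ∃ T, IsRange S T ∧ capt X T = Y := by
  classical
  rw [capturedFinset, Finset.mem_filter, Finset.mem_powersetCard]
  constructor
  · rintro ⟨⟨-, h1⟩, h2⟩
    exact ⟨h1, h2⟩
  · rintro ⟨h1, T, hT, rfl⟩
    exact ⟨⟨capt_subset, h1⟩, T, hT, rfl⟩

open scoped Classical in
lemma sum_card_ranges {S : Set Pt} (hS : NiceShape S) {X : Finset Pt} (hX : GenPos S X) (k : ℕ) :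
    ∑ Y ∈ capturedFinset S X k, ((rangesFinset hS hX k).filter fun T => capt X T = Y).card =
      (rangesFinset hS hX k).card := by
  refine (Finset.card_eq_sum_card_fiberwise fun T hT => ?_).symm
  obtain ⟨hT, hc, -⟩ := mem_rangesFinset.1 (Finset.mem_coe.1 hT)
  exact Finset.mem_coe.2 (mem_capturedFinset.2 ⟨hc, T, hT, rfl⟩)

lemma card_ranges_add_two_mul_card_captured {S : Set Pt} (hS : NiceShape S) {X : Finset Pt}
    (hX : GenPos S X) {k : ℕ} (hk : 2 ≤ k) :
    (rangesFinset hS hX k).card + 2 * (capturedFinset S X k).card =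
      3 * (rangesFinset hS hX (k + 1)).card + (repHalfplanes X k).ncard := by
  classical
  have h1 := sum_card_generic hS hX k
  have h2 : ∑ z ∈ X.offDiag, ((X.powersetCard k).filter fun Y => Generic S X Y z.1 z.2).card =
      ∑ Y ∈ X.powersetCard k, (X.offDiag.filter fun z => Generic S X Y z.1 z.2).card :=
    Finset.sum_card_bipartiteAbove_eq_sum_card_bipartiteBelow _
  have h3 : ∑ Y ∈ X.powersetCard k, (X.offDiag.filter fun z => Generic S X Y z.1 z.2).card =
      ∑ Y ∈ capturedFinset S X k, (X.offDiag.filter fun z => Generic S X Y z.1 z.2).card := by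
    refine (Finset.sum_subset (Finset.filter_subset _ _) fun Y hY hY' => ?_).symm
    rw [Finset.card_eq_zero, Finset.filter_eq_empty_iff]
    rintro z - ⟨T, hT, hc, -⟩
    exact hY' (mem_capturedFinset.2 ⟨(Finset.mem_powersetCard.1 hY).2, T, hT, hc⟩)
  have h4 : ∑ Y ∈ capturedFinset S X k, (X.offDiag.filter fun z => Generic S X Y z.1 z.2).card =
      ∑ Y ∈ capturedFinset S X k,
        (4 * ((rangesFinset hS hX k).filter fun T => capt X T = Y).card + 2) := by
    refine Finset.sum_congr rfl fun Y hY => ?_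
    obtain ⟨rfl, T, hT, rfl⟩ := mem_capturedFinset.1 hY
    obtain ⟨p, hp, q, hq, hpq, T₀, hT₀, hc, hb⟩ := exists_generic hS hX hT hk
    exact IsReference.card_generic_pairs ⟨hT₀, hc, by rw [hb, Finset.card_pair hpq]⟩ hS hX
  rw [Finset.sum_add_distrib, ← Finset.mul_sum, sum_card_ranges, Finset.sum_const,
    smul_eq_mul] at h4
  omega

lemma repRanges_coe {S : Set Pt} (hS : NiceShape S) {X : Finset Pt} (hX : GenPos S X)
    {Y : Finset Pt} {k : ℕ} (hY : Y.card = k) :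
    repRanges S X Y = {T | T ∈ rangesFinset hS hX k ∧ capt X T = Y} := by
  ext T
  rw [mem_ofPred_eq, mem_rangesFinset, repRanges, mem_ofPred_eq, ← coe_capt, ← coe_bdry,
    ncard_coe_finset, Finset.coe_inj]
  constructor
  · rintro ⟨h1, rfl, h3⟩
    exact ⟨⟨h1, hY, h3⟩, rfl⟩
  · rintro ⟨⟨h1, -, h3⟩, h2⟩
    exact ⟨h1, h2, h3⟩

lemma ncard_typeIRanges {S : Set Pt} (hS : NiceShape S) {X : Finset Pt} (hX : GenPos S X) (k : ℕ) :
    (typeIRanges S X k).ncard = (rangesFinset hS hX k).card :=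
  ncard_eq_toFinset_card _ _

open scoped Classical in
lemma typeIEdges_eq {S : Set Pt} {X : Finset Pt} {k : ℕ} :
    typeIEdges S X k = ((↑) : Finset Pt → Set Pt) ''
      ((capturedFinset S X k).filter fun Y : Finset Pt => (repRanges S X Y).Nonempty :
        Finset (Finset Pt)) := by
  ext Y
  simp only [mem_image, Finset.mem_coe, Finset.mem_filter, mem_capturedFinset]
  constructor
  · rintro ⟨-, hYk, T, hT⟩
    obtain ⟨h1, rfl, h3⟩ := hT
    rw [← coe_capt, ncard_coe_finset] at hYk
    exact ⟨capt X T, ⟨⟨hYk, T, h1, rfl⟩, T, h1, (coe_capt X T).symm, h3⟩, coe_capt X T⟩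
  · rintro ⟨_, ⟨⟨hc, T, hT, rfl⟩, hne⟩, rfl⟩
    exact ⟨Finset.coe_subset.2 capt_subset, (ncard_coe_finset _).trans hc, hne⟩

open scoped Classical in
lemma typeIIEdges_eq {S : Set Pt} {X : Finset Pt} {k : ℕ} :
    typeIIEdges S X k = ((↑) : Finset Pt → Set Pt) ''
      ((capturedFinset S X k).filter fun Y : Finset Pt => ¬ (repRanges S X Y).Nonempty :
        Finset (Finset Pt)) := by
  ext Y
  simp only [mem_image, Finset.mem_coe, Finset.mem_filter, mem_capturedFinset]
  constructor
  · rintro ⟨⟨-, hYk, T, hT, rfl⟩, hne⟩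
    rw [← coe_capt] at hYk hne
    rw [ncard_coe_finset] at hYk
    exact ⟨capt X T, ⟨⟨hYk, T, hT, rfl⟩, hne⟩, coe_capt X T⟩
  · rintro ⟨_, ⟨⟨hc, T, hT, rfl⟩, hne⟩, rfl⟩
    exact ⟨⟨Finset.coe_subset.2 capt_subset, (ncard_coe_finset _).trans hc, T, hT,
      (coe_capt X T).symm⟩, hne⟩

/-- the identity
`3|ℛ₁ᵏ| + 2|ℰ₂ᵏ| = 3|ℛ₁^{k+1}| + |𝒜ₖ| + 2·∑_{Y ∈ ℰ₁ᵏ} (|ℛ(Y)| − 1)`. -/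
theorem typeI_typeII_identity
    (S : Set Pt) (hS : NiceShape S) (X : Finset Pt) (hX : GenPos S X)
    (k : ℕ) (hk : 3 ≤ k) :
    3 * (typeIRanges S X k).ncard + 2 * (typeIIEdges S X k).ncard =
      3 * (typeIRanges S X (k + 1)).ncard + (repHalfplanes X k).ncard +
        2 * ∑ᶠ Y ∈ typeIEdges S X k, ((repRanges S X Y).ncard - 1) := by
  classical
  have hmain := card_ranges_add_two_mul_card_captured hS hX (show 2 ≤ k by omega)
  have hinj : Function.Injective ((↑) : Finset Pt → Set Pt) := Finset.coe_injective
  have hr : ∀ Y ∈ capturedFinset S X k, (repRanges S X Y).ncard =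
      ((rangesFinset hS hX k).filter fun T => capt X T = Y).card := by
    intro Y hY
    rw [repRanges_coe hS hX (mem_capturedFinset.1 hY).1, ← ncard_coe_finset, Finset.coe_filter]
  have hsum : ∑ Y ∈ capturedFinset S X k, (repRanges S X Y).ncard =
      (rangesFinset hS hX k).card := by
    rw [Finset.sum_congr rfl hr, sum_card_ranges]
  have hfin : ∀ Y ∈ capturedFinset S X k, (repRanges S X Y).Finite := by
    intro Y hY
    rw [repRanges_coe hS hX (mem_capturedFinset.1 hY).1]
    exact (rangesFinset hS hX k).finite_toSet.subset fun T hT => hT.1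
  have hII : ∑ Y ∈ (capturedFinset S X k).filter (fun Y : Finset Pt =>
      ¬ (repRanges S X Y).Nonempty), (repRanges S X Y).ncard = 0 := by
    refine Finset.sum_eq_zero fun Y hY => ?_
    rw [not_nonempty_iff_eq_empty.1 (Finset.mem_filter.1 hY).2, ncard_empty]
  have hI : ∑ Y ∈ (capturedFinset S X k).filter (fun Y : Finset Pt => (repRanges S X Y).Nonempty),
      ((repRanges S X Y).ncard - 1) +
      ((capturedFinset S X k).filter fun Y : Finset Pt => (repRanges S X Y).Nonempty).card =
      ∑ Y ∈ (capturedFinset S X k).filter (fun Y : Finset Pt => (repRanges S X Y).Nonempty),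
        (repRanges S X Y).ncard := by
    rw [Finset.card_eq_sum_ones, ← Finset.sum_add_distrib]
    refine Finset.sum_congr rfl fun Y hY => Nat.sub_add_cancel ?_
    obtain ⟨hY, hne⟩ := Finset.mem_filter.1 hY
    exact (ncard_pos (hfin Y hY)).2 hne
  have hsplit := Finset.sum_filter_add_sum_filter_not (capturedFinset S X k)
    (fun Y : Finset Pt => (repRanges S X Y).Nonempty) fun Y : Finset Pt => (repRanges S X Y).ncard
  have hcard := Finset.card_filter_add_card_filter_not (s := capturedFinset S X k)
    (fun Y : Finset Pt => (repRanges S X Y).Nonempty)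
  rw [typeIEdges_eq, typeIIEdges_eq, finsum_mem_image hinj.injOn, finsum_mem_coe_finset,
    hinj.injOn.ncard_image, ncard_coe_finset, ncard_typeIRanges hS hX, ncard_typeIRanges hS hX]
  omega
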